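/- Fix a prime ℓ, an algebraically closed field k of characteristic ℓ, an integer r ≥ 2, and an integer n > 1. Then the number of pairs (q, [V]), where q is a prime power not divisible by ℓ with (r, q) ∉ {(2,2),(2,3),(2,4),(2,5),(3,2),(3,3),(5,2),(5,3)}, and [V] is an isomorphism class of nontrivial irreducible k-linear representations of SL_{r+1}(F_q) of dimension n with n ≤ (q^{r+1} − 1)/(q − 1), is strictly less than n^{1/r}. -/

import Mathlib

/-- A representation is irreducible if the only invariant submodules are `⊥` and `⊤`. -/
def Representation.IsIrred {k H V : Type*} [Field k] [Group H] [AddCommGroup V] [Module k V]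
    (ρ : Representation k H V) : Prop :=
  ∀ U : Submodule k V, (∀ h : H, ∀ v ∈ U, ρ h v ∈ U) → U = ⊥ ∨ U = ⊤

/-- The setoid identifying isomorphic (equivariantly linearly equivalent) representations
of `H` on `Fin n → k` satisfying a property `P`.  The classes of this setoid are exactly the
isomorphism classes of `n`-dimensional representations of `H` over `k` satisfying `P`. -/
def repIsoSetoid (k H : Type*) [Field k] [Group H] (n : ℕ)
    (P : Representation k H (Fin n → k) → Prop) :
    Setoid {ρ : Representation k H (Fin n → k) // P ρ} where
  r ρ₁ ρ₂ := ∃ e : (Fin n → k) ≃ₗ[k] (Fin n → k), ∀ (h : H) (v : Fin n → k),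
    e (ρ₁.1 h v) = ρ₂.1 h (e v)
  iseqv := by
    constructor
    · exact fun ρ => ⟨LinearEquiv.refl k _, fun _ _ => rfl⟩
    · rintro a b ⟨e, he⟩
      refine ⟨e.symm, fun h v => ?_⟩
      rw [LinearEquiv.symm_apply_eq, he, e.apply_symm_apply]
    · rintro a b c ⟨e, he⟩ ⟨f, hf⟩
      refine ⟨e.trans f, fun h v => ?_⟩
      simp [LinearEquiv.trans_apply, he, hf]

namespace SLRep
open Matrix

section

variable {F : Type*} [Field F] {d : ℕ}

/-- The special linear group of degree `d`. -/
abbrev SL (d : ℕ) (F : Type*) [Field F] := Matrix.SpecialLinearGroup (Fin d) F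

theorem smul_eq (g : SL d F) (x : Fin d → F) : g • x = g.1 *ᵥ x := rfl

theorem ext_smul {g h : SL d F} (H : ∀ x : Fin d → F, g • x = h • x) : g = h := by
  apply Subtype.ext
  apply Matrix.toLin'.injective
  exact LinearMap.ext H

theorem det_one_add_vecMulVec (x φ : Fin d → F) : (1 + vecMulVec x φ).det = 1 + φ ⬝ᵥ x := by
  rw [vecMulVec_eq Unit, det_one_add_replicateCol_mul_replicateRow]

open Classical in
/-- The transvection `y ↦ y + (φ ⬝ᵥ y) • x` (and `1` when `φ ⬝ᵥ x ≠ 0`). -/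
noncomputable def T (x φ : Fin d → F) : SL d F :=
  if h : φ ⬝ᵥ x = 0 then
    (⟨1 + vecMulVec x φ, by rw [det_one_add_vecMulVec, h, add_zero]⟩ : SL d F)
  else 1

theorem T_smul {x φ : Fin d → F} (h : φ ⬝ᵥ x = 0) (y : Fin d → F) :
    T x φ • y = y + (φ ⬝ᵥ y) • x := by
  have : (T x φ).1 = 1 + vecMulVec x φ := by simp [T, h]
  rw [smul_eq, this]
  simp [add_mulVec, vecMulVec_mulVec]

/-- The contragredient automorphism `g ↦ (g⁻¹)ᵀ`. -/
def ct : SL d F →* SL d F where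
  toFun g := (g⁻¹).transpose
  map_one' := by
    apply Subtype.ext
    simp [SpecialLinearGroup.coe_transpose]
  map_mul' g h := by
    apply Subtype.ext
    simp [SpecialLinearGroup.coe_transpose]

theorem ct_dot (g : SL d F) (φ x : Fin d → F) : (ct g • φ) ⬝ᵥ x = φ ⬝ᵥ (g⁻¹ • x) := by
  rw [smul_eq, smul_eq]
  change ((g⁻¹).transpose).1 *ᵥ φ ⬝ᵥ x = _
  rw [SpecialLinearGroup.coe_transpose, mulVec_transpose, dotProduct_mulVec]

theorem ct_dot_smul (g : SL d F) (φ x : Fin d → F) : (ct g • φ) ⬝ᵥ (g • x) = φ ⬝ᵥ x := by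
  rw [ct_dot, inv_smul_smul]

theorem dot_ext {φ ψ : Fin d → F} (h : ∀ x, φ ⬝ᵥ x = ψ ⬝ᵥ x) : φ = ψ :=
  (dotProductEquiv F (Fin d)).injective (LinearMap.ext h)

theorem ct_ct (g : SL d F) : ct (ct g) = g := by
  apply ext_smul
  intro x
  apply dot_ext
  intro y
  rw [ct_dot, ← map_inv, dotProduct_comm, ct_dot, inv_inv, dotProduct_comm]

theorem T_zero_left (φ : Fin d → F) : T (0 : Fin d → F) φ = 1 :=
  ext_smul fun y => by rw [T_smul (by simp)]; simp

theorem T_zero_right (x : Fin d → F) : T x (0 : Fin d → F) = 1 :=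
  ext_smul fun y => by rw [T_smul (by simp)]; simp

theorem T_add_right {x φ χ : Fin d → F} (h : φ ⬝ᵥ x = 0) (h' : χ ⬝ᵥ x = 0) :
    T x (φ + χ) = T x φ * T x χ :=
  ext_smul fun y => by
    rw [mul_smul, T_smul h', T_smul h, T_smul (by simp [add_dotProduct, h, h'])]
    simp only [add_dotProduct, dotProduct_add, dotProduct_smul, h, add_smul, smul_zero, add_zero]
    abel

theorem T_add_left {x y φ : Fin d → F} (h : φ ⬝ᵥ x = 0) (h' : φ ⬝ᵥ y = 0) :
    T (x + y) φ = T x φ * T y φ :=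
  ext_smul fun z => by
    rw [mul_smul, T_smul h', T_smul h, T_smul (by simp [dotProduct_add, h, h'])]
    simp only [dotProduct_add, dotProduct_smul, h', smul_add, smul_zero, add_zero]
    abel

theorem T_neg_right {x φ : Fin d → F} (h : φ ⬝ᵥ x = 0) : T x (-φ) = (T x φ)⁻¹ := by
  rw [eq_inv_iff_mul_eq_one, ← T_add_right (by simp [h]) h, neg_add_cancel, T_zero_right]

theorem T_smul_smul {x φ : Fin d → F} (h : φ ⬝ᵥ x = 0) (a : F) : T (a • x) φ = T x (a • φ) :=
  ext_smul fun y => by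
    rw [T_smul (by simp [h]), T_smul (by simp [h])]
    simp [smul_smul, mul_comm]

theorem conj_T (g : SL d F) {x φ : Fin d → F} (h : φ ⬝ᵥ x = 0) :
    g * T x φ * g⁻¹ = T (g • x) (ct g • φ) :=
  ext_smul fun y => by
    rw [T_smul (by rw [ct_dot_smul, h]), mul_smul, mul_smul, T_smul h, smul_add, smul_inv_smul,
      ct_dot, smul_comm]

theorem mul_T (g : SL d F) {x φ : Fin d → F} (h : φ ⬝ᵥ x = 0) :
    g * T x φ = T (g • x) (ct g • φ) * g := by
  rw [← conj_T g h]; group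

theorem ct_T {x φ : Fin d → F} (h : φ ⬝ᵥ x = 0) : ct (T x φ) = T φ (-x) := by
  apply ext_smul
  intro y
  apply dot_ext
  intro z
  rw [ct_dot, ← T_neg_right h, T_smul (by simp [h]),
    T_smul (by rw [neg_dotProduct, dotProduct_comm, h, neg_zero])]
  simp [dotProduct_comm, mul_comm]

theorem ct_T_smul {x φ : Fin d → F} (h : φ ⬝ᵥ x = 0) (y : Fin d → F) :
    ct (T x φ) • y = y - (y ⬝ᵥ x) • φ := by
  rw [ct_T h, T_smul (by rw [neg_dotProduct, dotProduct_comm, h, neg_zero])]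
  simp [dotProduct_comm, sub_eq_add_neg]

theorem comm_T {x y φ χ : Fin d → F} (h1 : φ ⬝ᵥ x = 0) (h2 : χ ⬝ᵥ x = 0) (h3 : χ ⬝ᵥ y = 0) :
    T x φ * T y χ * (T x φ)⁻¹ * (T y χ)⁻¹ = T x ((φ ⬝ᵥ y) • χ) := by
  rw [conj_T _ h3, T_smul h1, ct_T_smul h1, h2, zero_smul, sub_zero, add_comm y,
    T_add_left (by simp [h2]) h3, mul_inv_cancel_right, T_smul_smul h2]

theorem exists_sep (p : Submodule F (Fin d → F)) {y : Fin d → F} (hy : y ∉ p) :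
    ∃ φ : Fin d → F, (∀ x ∈ p, φ ⬝ᵥ x = 0) ∧ φ ⬝ᵥ y = 1 := by
  obtain ⟨f, hf, hp⟩ := Submodule.exists_le_ker_of_notMem hy
  obtain ⟨φ, rfl⟩ := (dotProductEquiv F (Fin d)).surjective f
  simp only [dotProductEquiv_apply_apply] at hf
  refine ⟨(φ ⬝ᵥ y)⁻¹ • φ, fun x hx => ?_, ?_⟩
  · have : φ ⬝ᵥ x = 0 := hp hx
    simp [this]
  · simp [hf]

/-- The subgroup generated by transvections fixing `p` pointwise. -/
def TV (p : Submodule F (Fin d → F)) : Subgroup (SL d F) :=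
  Subgroup.closure {g | ∃ x φ : Fin d → F, φ ⬝ᵥ x = 0 ∧ (∀ y ∈ p, φ ⬝ᵥ y = 0) ∧ g = T x φ}

theorem T_mem_TV {p : Submodule F (Fin d → F)} {x φ : Fin d → F} (h : φ ⬝ᵥ x = 0)
    (hp : ∀ y ∈ p, φ ⬝ᵥ y = 0) : T x φ ∈ TV p :=
  Subgroup.subset_closure ⟨x, φ, h, hp, rfl⟩

theorem TV_anti {p q : Submodule F (Fin d → F)} (h : p ≤ q) : TV q ≤ TV p := by
  rw [TV, Subgroup.closure_le]
  rintro _ ⟨x, φ, hx, hq, rfl⟩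
  exact T_mem_TV hx fun y hy => hq y (h hy)

theorem TV_fix {p : Submodule F (Fin d → F)} {g : SL d F} (hg : g ∈ TV p) :
    ∀ y ∈ p, g • y = y := by
  induction hg using Subgroup.closure_induction with
  | mem g h =>
    obtain ⟨x, φ, hx, hp, rfl⟩ := h
    intro y hy
    rw [T_smul hx, hp y hy]; simp
  | one => simp
  | mul g h _ _ hg hh => intro y hy; rw [mul_smul, hh y hy, hg y hy]
  | inv g _ hg => intro y hy; rw [inv_smul_eq_iff, hg y hy]

theorem exists_TV_smul_eq_of_notMem_sup {p : Submodule F (Fin d → F)} {x y : Fin d → F} (hx : x ∉ p)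
    (hy : y ∉ p ⊔ F ∙ x) : ∃ h ∈ TV p, h • x = y := by
  have hx' : x ∉ p ⊔ F ∙ (y - x) := by
    intro h
    obtain ⟨e, he, z, hz, hez⟩ := Submodule.mem_sup.1 h
    obtain ⟨c, rfl⟩ := Submodule.mem_span_singleton.1 hz
    rcases eq_or_ne c 0 with rfl | hc
    · simp at hez; exact hx (hez ▸ he)
    · apply hy
      have : y = -c⁻¹ • e + (c⁻¹ + 1) • x := by
        have h1 : c⁻¹ • x = c⁻¹ • e + (y - x) := by
          conv_lhs => rw [← hez, smul_add, inv_smul_smul₀ hc]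
        rw [add_smul, h1]; module
      rw [this]
      exact Submodule.add_mem_sup (p.smul_mem _ he)
        (Submodule.smul_mem _ _ (Submodule.mem_span_singleton_self x))
  obtain ⟨φ, hφ, hφx⟩ := exists_sep _ hx'
  have h0 : φ ⬝ᵥ (y - x) = 0 :=
    hφ _ (Submodule.mem_sup_right (Submodule.mem_span_singleton_self _))
  exact ⟨T (y - x) φ, T_mem_TV h0 fun z hz => hφ z (Submodule.mem_sup_left hz), by
    rw [T_smul h0, hφx]; simp⟩

theorem exists_notMem {p : Submodule F (Fin d → F)} (h : Module.finrank F p < d) :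
    ∃ z, z ∉ p := by
  by_contra! H
  have : p = ⊤ := eq_top_iff.2 fun z _ => H z
  subst this
  simp at h

theorem finrank_sup_span_le (p : Submodule F (Fin d → F)) (x : Fin d → F) :
    Module.finrank F ↥(p ⊔ F ∙ x) ≤ Module.finrank F p + 1 :=
  (Submodule.finrank_add_le_finrank_add_finrank _ _).trans
    (Nat.add_le_add_left ((finrank_span_le_card _).trans (by simp)) _)

theorem exists_TV_smul_eq {p : Submodule F (Fin d → F)} {x y : Fin d → F} (hd : Module.finrank F p + 2 ≤ d)
    (hx : x ∉ p) (hy : y ∉ p) : ∃ h ∈ TV p, h • x = y := by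
  by_cases hyx : y ∈ p ⊔ F ∙ x
  · obtain ⟨z, hz⟩ := exists_notMem (p := p ⊔ F ∙ x)
      (by have := finrank_sup_span_le p x; omega)
    have hz' : z ∉ p ⊔ F ∙ y := fun h => hz (by
      refine (sup_le le_sup_left ?_ : p ⊔ F ∙ y ≤ p ⊔ F ∙ x) h
      rwa [Submodule.span_singleton_le_iff_mem])
    obtain ⟨h1, hh1, e1⟩ := exists_TV_smul_eq_of_notMem_sup hx hz
    obtain ⟨h2, hh2, e2⟩ := exists_TV_smul_eq_of_notMem_sup hy hz'
    exact ⟨h2⁻¹ * h1, mul_mem (inv_mem hh2) hh1, by rw [mul_smul, e1, inv_smul_eq_iff, e2]⟩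
  · exact exists_TV_smul_eq_of_notMem_sup hx hyx

theorem mem_TV_of_fix {p : Submodule F (Fin d → F)} {g : SL d F} (hg : ∀ y ∈ p, g • y = y) :
    g ∈ TV p := by
  induction hn : d - Module.finrank F p using Nat.strong_induction_on generalizing p g with
  | _ n ih =>
  have hle : Module.finrank F p ≤ d := by simpa using p.finrank_le
  by_cases htop : p = ⊤
  · rw [show g = 1 from ext_smul fun x => by rw [hg x (htop ▸ trivial), one_smul]]
    exact one_mem _
  obtain ⟨x, -, hx⟩ := SetLike.exists_of_lt (lt_top_iff_ne_top.2 htop)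
  have hgx : g • x ∉ p := fun h => hx (by
    have := smul_left_cancel g (hg _ h)
    rwa [this] at h)
  by_cases hd : Module.finrank F p + 2 ≤ d
  · obtain ⟨h, hh, e⟩ := exists_TV_smul_eq hd hgx hx
    have hfix : ∀ y ∈ p ⊔ F ∙ x, (h * g) • y = y := by
      intro y hy
      obtain ⟨a, ha, z, hz, rfl⟩ := Submodule.mem_sup.1 hy
      obtain ⟨c, rfl⟩ := Submodule.mem_span_singleton.1 hz
      rw [smul_add, mul_smul, hg a ha, TV_fix hh a ha, smul_comm, mul_smul, e]
    have hlt : Module.finrank F p < Module.finrank F ↥(p ⊔ F ∙ x) := by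
      apply Submodule.finrank_lt_finrank_of_lt
      refine lt_of_le_of_ne le_sup_left fun h => hx ?_
      rw [h]; exact Submodule.mem_sup_right (Submodule.mem_span_singleton_self _)
    have := ih _ (by omega) hfix rfl
    have := mul_mem (inv_mem hh) (TV_anti le_sup_left this)
    rwa [inv_mul_cancel_left] at this
  · obtain ⟨φ, hφ, hφx⟩ := exists_sep p hx
    have hall : ∀ y, y ∈ p ⊔ F ∙ x := by
      by_contra! h
      obtain ⟨y, hy⟩ := h
      have hlt : Module.finrank F p < Module.finrank F ↥(p ⊔ F ∙ x) := by
        apply Submodule.finrank_lt_finrank_of_lt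
        refine lt_of_le_of_ne le_sup_left fun h => hx ?_
        rw [h]; exact Submodule.mem_sup_right (Submodule.mem_span_singleton_self _)
      have hlt2 : Module.finrank F ↥(p ⊔ F ∙ x) < d := by
        have := Submodule.finrank_lt (s := p ⊔ F ∙ x) (fun h => hy (h ▸ trivial))
        simpa using this
      omega
    have key : ∀ y, g • y = y + (φ ⬝ᵥ y) • (g • x - x) := by
      intro y
      obtain ⟨a, ha, z, hz, rfl⟩ := Submodule.mem_sup.1 (hall y)
      obtain ⟨c, rfl⟩ := Submodule.mem_span_singleton.1 hz
      rw [smul_add, hg a ha, smul_comm, dotProduct_add, hφ a ha, dotProduct_smul, hφx]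
      simp only [smul_eq_mul, mul_one, zero_add]
      generalize g • x = w
      module
    have h0 : φ ⬝ᵥ (g • x - x) = 0 := by
      have hm : g.1 = 1 + vecMulVec (g • x - x) φ := by
        apply Matrix.toLin'.injective
        apply LinearMap.ext
        intro y
        rw [toLin'_apply, toLin'_apply, ← smul_eq, key, add_mulVec, vecMulVec_mulVec, one_mulVec]
        simp
      have := g.2
      rw [hm, det_one_add_vecMulVec] at this
      simpa using this
    have : g = T (g • x - x) φ := ext_smul fun y => by rw [key, T_smul h0]
    rw [this]
    exact T_mem_TV h0 hφ

end

section

variable {F : Type*} [Field F] {d : ℕ}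

/-- `e` and `u` are linearly independent. -/
def Ind (e u : Fin d → F) : Prop := e ≠ 0 ∧ u ∉ F ∙ e

theorem smul_mem_span_iff (g : SL d F) (e u : Fin d → F) : g • u ∈ F ∙ (g • e) ↔ u ∈ F ∙ e := by
  simp only [Submodule.mem_span_singleton]
  refine exists_congr fun a => ?_
  rw [← smul_comm]
  exact ⟨fun h => smul_left_cancel g h, fun h => by rw [h]⟩

theorem Ind.smul {e u : Fin d → F} (h : Ind e u) (g : SL d F) : Ind (g • e) (g • u) :=
  ⟨(smul_ne_zero_iff_ne g).2 h.1, by rw [smul_mem_span_iff]; exact h.2⟩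

theorem ind_of_dot {e u φ : Fin d → F} (he : e ≠ 0) (h0 : φ ⬝ᵥ e = 0) (h1 : φ ⬝ᵥ u ≠ 0) :
    Ind e u := by
  refine ⟨he, fun h => h1 ?_⟩
  obtain ⟨c, rfl⟩ := Submodule.mem_span_singleton.1 h
  simp [h0]

theorem Ind.exists_sep {e u : Fin d → F} (h : Ind e u) :
    ∃ φ : Fin d → F, φ ⬝ᵥ e = 0 ∧ φ ⬝ᵥ u = 1 := by
  obtain ⟨φ, h1, h2⟩ := SLRep.exists_sep _ h.2
  exact ⟨φ, h1 _ (Submodule.mem_span_singleton_self e), h2⟩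

theorem Ind.right_ne {e u : Fin d → F} (h : Ind e u) : u ≠ 0 := fun h0 => h.2 (h0 ▸ zero_mem _)

theorem Ind.symm {e u : Fin d → F} (h : Ind e u) : Ind u e := by
  refine ⟨h.right_ne, fun h' => ?_⟩
  obtain ⟨c, rfl⟩ := Submodule.mem_span_singleton.1 h'
  have hc : c ≠ 0 := by rintro rfl; exact h.1 (zero_smul _ _)
  exact h.2 (Submodule.mem_span_singleton.2 ⟨c⁻¹, inv_smul_smul₀ hc u⟩)

theorem Ind.add_smul {e u : Fin d → F} (h : Ind e u) (t : F) : Ind e (u + t • e) :=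
  ⟨h.1, fun h' => h.2 ((Submodule.add_mem_iff_left _
    (Submodule.smul_mem _ t (Submodule.mem_span_singleton_self e))).1 h')⟩

theorem Ind.smul_left {e u : Fin d → F} (h : Ind e u) {a : F} (ha : a ≠ 0) : Ind (a • e) u := by
  refine ⟨smul_ne_zero ha h.1, fun h' => h.2 ?_⟩
  obtain ⟨c, rfl⟩ := Submodule.mem_span_singleton.1 h'
  exact Submodule.mem_span_singleton.2 ⟨c * a, mul_smul _ _ _⟩

theorem Ind.smul_right {e u : Fin d → F} (h : Ind e u) {a : F} (ha : a ≠ 0) : Ind e (a • u) :=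
  (h.symm.smul_left ha).symm

theorem finrank_span_pair_le (e u : Fin d → F) :
    Module.finrank F ↥(Submodule.span F {e, u}) ≤ 2 := by
  classical
  have := finrank_span_finset_le_card (R := F) ({e, u} : Finset (Fin d → F))
  rw [Finset.coe_pair] at this
  exact this.trans Finset.card_le_two

theorem finrank_span_triple_le (e u x : Fin d → F) :
    Module.finrank F ↥(Submodule.span F {e, u, x}) ≤ 3 := by
  classical
  have := finrank_span_finset_le_card (R := F) ({e, u, x} : Finset (Fin d → F))
  simp only [Finset.coe_insert, Finset.coe_singleton] at this
  exact this.trans Finset.card_le_three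

theorem exists_ind (hd : 2 ≤ d) : ∃ e u : Fin d → F, Ind e u := by
  obtain ⟨e, he⟩ := exists_notMem (F := F) (d := d) (p := ⊥) (by simp; omega)
  obtain ⟨u, hu⟩ := exists_notMem (F := F) (d := d) (p := F ∙ e)
    (((finrank_span_le_card _).trans (by simp) : _ ≤ 1).trans_lt (by omega))
  exact ⟨e, u, by simpa using he, hu⟩

theorem trans_ind (hd : 3 ≤ d) {e u e' u' : Fin d → F} (h : Ind e u) (h' : Ind e' u') :
    ∃ g : SL d F, g • e = e' ∧ g • u = u' := by
  obtain ⟨g, -, hg⟩ := exists_TV_smul_eq (p := ⊥) (x := e) (y := e') (by simp; omega) (by simpa using h.1)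
    (by simpa using h'.1)
  have h1 : g • u ∉ F ∙ e' := by rw [← hg, smul_mem_span_iff]; exact h.2
  obtain ⟨g', hg', e2⟩ := exists_TV_smul_eq (p := F ∙ e') (by
    rw [finrank_span_singleton h'.1]; omega) h1 h'.2
  exact ⟨g' * g, by rw [mul_smul, hg, TV_fix hg' _ (Submodule.mem_span_singleton_self _)],
    by rw [mul_smul, e2]⟩

theorem fix_span_pair {g : SL d F} {e u : Fin d → F} (he : g • e = e) (hu : g • u = u) :
    ∀ y ∈ Submodule.span F {e, u}, g • y = y := by
  intro y hy
  obtain ⟨a, b, rfl⟩ := Submodule.mem_span_pair.1 hy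
  rw [smul_add, smul_comm, smul_comm g b, he, hu]

/-- Functionals killing `e`. -/
def perp (e : Fin d → F) : Submodule F (Fin d → F) where
  carrier := {χ | χ ⬝ᵥ e = 0}
  add_mem' := fun {a b} ha hb => by
    simp only [Set.mem_ofPred_eq] at *
    simp [add_dotProduct, ha, hb]
  zero_mem' := by simp
  smul_mem' := fun c x hx => by
    simp only [Set.mem_ofPred_eq] at *
    simp [hx]

@[simp] theorem mem_perp {e χ : Fin d → F} : χ ∈ perp e ↔ χ ⬝ᵥ e = 0 := Iff.rfl

theorem finrank_perp {e : Fin d → F} (he : e ≠ 0) : Module.finrank F (perp e) + 1 = d := by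
  have h : perp e = LinearMap.ker (dotProductEquiv F (Fin d) e) := by
    ext x
    simp [dotProduct_comm]
  rw [h, Module.Dual.finrank_ker_add_one_of_ne_zero (by simpa using he)]
  simp

variable {k : Type*} [Field k]

theorem sum_char_eq_zero {A : Type*} [AddCommGroup A] [Module F A] [Fintype A] {ψ : AddChar F k}
    (hψ : ψ ≠ 1) (f : A →ₗ[F] F) (hf : f ≠ 0) : ∑ a, ψ (f a) = 0 := by
  refine AddChar.sum_eq_zero_of_ne_one (ψ := ψ.compAddMonoidHom f.toAddMonoidHom) ?_
  intro h
  obtain ⟨t, ht⟩ := AddChar.ne_one_iff.1 hψ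
  obtain ⟨a, ha⟩ : ∃ a, f a ≠ 0 := by
    by_contra! h; exact hf (LinearMap.ext h)
  apply ht
  have := DFunLike.congr_fun h ((t / f a) • a)
  simpa [ha] using this

/-- Sum over the functionals killing `e`. -/
theorem sum_perp [Fintype F] [Fintype (perp (F := F) (d := d) e)] {ψ : AddChar F k}
    (hψ : ψ ≠ 1) {u : Fin d → F}
    (h : ∃ χ : Fin d → F, χ ⬝ᵥ e = 0 ∧ χ ⬝ᵥ u ≠ 0) :
    ∑ χ : perp e, ψ (χ.1 ⬝ᵥ u) = 0 := by
  obtain ⟨χ, h0, h1⟩ := h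
  let f : perp e →ₗ[F] F :=
    { toFun := fun χ => χ.1 ⬝ᵥ u
      map_add' := fun x y => by simp [add_dotProduct]
      map_smul' := fun c x => by simp }
  exact sum_char_eq_zero hψ f fun hf => h1 (LinearMap.congr_fun hf ⟨χ, h0⟩)

theorem exists_addChar [Fintype F] [IsAlgClosed k] (hq : (Fintype.card F : k) ≠ 0) :
    ∃ ψ : AddChar F k, ψ ≠ 1 := by
  have hne : ringChar k ≠ ringChar F := by
    intro h
    apply hq
    have : ringChar F ∣ Fintype.card F := by
      rw [← CharP.cast_eq_zero_iff F (ringChar F)]; simp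
    rw [← h] at this
    exact (ringChar.spec k _).2 this
  let P := AddChar.FiniteField.primitiveChar F k hne
  have : FiniteDimensional k (CyclotomicField P.n k) :=
    inferInstanceAs (FiniteDimensional k (Polynomial.cyclotomic P.n k).SplittingField)
  let f : CyclotomicField P.n k →ₐ[k] k := IsAlgClosed.lift
  refine ⟨⟨fun x => f (P.char x), by simp, fun a b => by simp [AddChar.map_add_eq_mul]⟩, ?_⟩
  have h1 := P.prim one_ne_zero
  rw [AddChar.mulShift_one] at h1
  rw [AddChar.ne_one_iff] at h1 ⊢
  obtain ⟨a, ha⟩ := h1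
  refine ⟨a, fun h => ha ?_⟩
  apply f.injective
  rw [map_one]
  exact h

end

section

variable {F : Type*} [Field F] {d : ℕ} {k : Type*} [Field k]
  {V : Type*} [AddCommGroup V] [Module k V]
  (ρ : Representation k (SL d F) V) (ψ : AddChar F k)

/-- The weight space of the group `{T e χ | χ ⬝ᵥ e = 0}` for the character `χ ↦ ψ (χ ⬝ᵥ u)`. -/
def E (e u : Fin d → F) : Submodule k V where
  carrier := {v | ∀ χ, χ ⬝ᵥ e = 0 → ρ (T e χ) v = ψ (χ ⬝ᵥ u) • v}
  add_mem' := fun {a b} ha hb χ h => by rw [map_add, ha χ h, hb χ h, smul_add]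
  zero_mem' := by simp
  smul_mem' := fun c x hx χ h => by rw [map_smul, hx χ h, smul_comm]

variable {ρ ψ}

theorem rho_mul (g h : SL d F) (v : V) : ρ (g * h) v = ρ g (ρ h v) := by
  rw [map_mul]; rfl

theorem rho_inv (g : SL d F) (v : V) : ρ g⁻¹ (ρ g v) = v := by
  rw [← rho_mul, inv_mul_cancel, map_one]; rfl

theorem rho_inv' (g : SL d F) (v : V) : ρ g (ρ g⁻¹ v) = v := by
  rw [← rho_mul, mul_inv_cancel, map_one]; rfl

theorem rho_injective (g : SL d F) : Function.Injective (ρ g) := fun v w h => by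
  rw [← rho_inv (ρ := ρ) g v, h, rho_inv]

theorem smul_mem_E (g : SL d F) {e u : Fin d → F} {v : V} (hv : v ∈ E ρ ψ e u) :
    ρ g v ∈ E ρ ψ (g • e) (g • u) := by
  intro χ hχ
  have h0 : (ct g⁻¹ • χ) ⬝ᵥ e = 0 := by rw [ct_dot, inv_inv, hχ]
  have := mul_T g h0
  rw [← mul_smul, ← map_mul, mul_inv_cancel, map_one, one_smul] at this
  rw [← rho_mul, ← this, rho_mul, hv _ h0, map_smul, ct_dot, inv_inv]

theorem mem_E_add {e u : Fin d → F} {v : V} (hv : v ∈ E ρ ψ e u) (t : F) :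
    v ∈ E ρ ψ e (u + t • e) := by
  intro χ hχ
  rw [hv χ hχ, dotProduct_add, dotProduct_smul, hχ, smul_zero, add_zero]

theorem mem_E_smul {e u : Fin d → F} {v : V} (hv : v ∈ E ρ ψ e u) (a : F) :
    v ∈ E ρ ψ (a • e) (a • u) := by
  intro χ hχ
  rcases eq_or_ne a 0 with rfl | ha
  · rw [zero_smul, T_zero_left, map_one]; simp
  · have h0 : χ ⬝ᵥ e = 0 := by
      rw [dotProduct_smul] at hχ
      simpa [ha] using hχ
    rw [T_smul_smul h0, hv _ (by simp [h0])]; simp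

theorem E_smul_eq {e u : Fin d → F} {a : F} (ha : a ≠ 0) : E ρ ψ (a • e) (a • u) = E ρ ψ e u := by
  refine le_antisymm (fun v hv => ?_) fun v hv => mem_E_smul hv a
  simpa [smul_smul, ha] using mem_E_smul hv a⁻¹

theorem finrank_E_le [FiniteDimensional k V] (g : SL d F) (e u : Fin d → F) :
    Module.finrank k (E ρ ψ e u) ≤ Module.finrank k (E ρ ψ (g • e) (g • u)) := by
  refine LinearMap.finrank_le_finrank_of_injective
    (f := (ρ g).restrict (p := E ρ ψ e u) (q := E ρ ψ (g • e) (g • u))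
      fun v hv => smul_mem_E g hv) ?_
  intro v w h
  apply Subtype.ext
  exact rho_injective (ρ := ρ) g (congrArg Subtype.val h)

theorem finrank_E_eq [FiniteDimensional k V] (hd : 3 ≤ d) {e u e' u' : Fin d → F} (h : Ind e u)
    (h' : Ind e' u') : Module.finrank k (E ρ ψ e u) = Module.finrank k (E ρ ψ e' u') := by
  obtain ⟨g, rfl, rfl⟩ := trans_ind hd h h'
  refine le_antisymm (finrank_E_le g e u) ?_
  have := finrank_E_le (ρ := ρ) (ψ := ψ) g⁻¹ (g • e) (g • u)
  rwa [inv_smul_smul, inv_smul_smul] at this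

section Fintype
variable [Fintype F]

noncomputable instance (e : Fin d → F) : Fintype (perp e) := Fintype.ofFinite _

theorem card_perp (e : Fin d → F) :
    Fintype.card (perp e) = Fintype.card F ^ Module.finrank F (perp e) :=
  Module.card_eq_pow_finrank

variable (ρ ψ) in
/-- The unnormalised projection onto `E ρ ψ e u`. -/
noncomputable def P (e u : Fin d → F) : V →ₗ[k] V :=
  ∑ χ : perp e, ψ (-(χ.1 ⬝ᵥ u)) • ρ (T e χ.1)

theorem P_apply (e u : Fin d → F) (v : V) :
    P ρ ψ e u v = ∑ χ : perp e, ψ (-(χ.1 ⬝ᵥ u)) • ρ (T e χ.1) v := by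
  simp [P]

theorem P_mem (e u : Fin d → F) (v : V) : P ρ ψ e u v ∈ E ρ ψ e u := by
  intro χ hχ
  rw [P_apply, map_sum, Finset.smul_sum]
  refine Fintype.sum_equiv (Equiv.addLeft (⟨χ, hχ⟩ : perp e)) _ _ fun χ' => ?_
  simp only [Equiv.coe_addLeft, Submodule.coe_add]
  rw [map_smul, T_add_right hχ χ'.2, rho_mul, smul_smul, ← AddChar.map_add_eq_mul, add_dotProduct]
  congr 2
  ring

theorem P_T {e u χ : Fin d → F} (hχ : χ ⬝ᵥ e = 0) (v : V) :
    P ρ ψ e u (ρ (T e χ) v) = ψ (χ ⬝ᵥ u) • P ρ ψ e u v := by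
  rw [P_apply, P_apply, Finset.smul_sum]
  refine Fintype.sum_equiv (Equiv.addRight (⟨χ, hχ⟩ : perp e)) _ _ fun χ' => ?_
  simp only [Equiv.coe_addRight, Submodule.coe_add]
  rw [T_add_right χ'.2 hχ, rho_mul, smul_smul, ← AddChar.map_add_eq_mul, add_dotProduct]
  congr 2
  ring

theorem P_of_mem {e u : Fin d → F} {v : V} (hv : v ∈ E ρ ψ e u) :
    P ρ ψ e u v = (Fintype.card (perp e) : k) • v := by
  rw [P_apply, Finset.sum_congr rfl (g := fun _ => v), Finset.sum_const, Finset.card_univ,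
    Nat.cast_smul_eq_nsmul]
  intro χ _
  rw [hv χ.1 χ.2, smul_smul, ← AddChar.map_add_eq_mul, neg_add_cancel, AddChar.map_zero_eq_one,
    one_smul]

theorem P_of_mem_ne (hψ : ψ ≠ 1) {e u u' : Fin d → F} {v : V} (hv : v ∈ E ρ ψ e u')
    (h : u' - u ∉ F ∙ e) : P ρ ψ e u v = 0 := by
  have : ∀ χ : perp e, ψ (-(χ.1 ⬝ᵥ u)) • ρ (T e χ.1) v = ψ (χ.1 ⬝ᵥ (u' - u)) • v := fun χ => by
    rw [hv χ.1 χ.2, smul_smul, ← AddChar.map_add_eq_mul, dotProduct_sub]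
    congr 2; ring
  rw [P_apply, Fintype.sum_congr _ _ this, ← Finset.sum_smul]
  obtain ⟨φ, h1, h2⟩ := exists_sep _ h
  rw [sum_perp hψ ⟨φ, h1 _ (Submodule.mem_span_singleton_self e), by simp [h2]⟩, zero_smul]

theorem sum_dot (hψ : ψ ≠ 1) {χ : Fin d → F} (h : χ ≠ 0) :
    ∑ u : Fin d → F, ψ (χ ⬝ᵥ u) = 0 :=
  sum_char_eq_zero hψ (dotProductEquiv F (Fin d) χ) (by simpa using h)

theorem sum_P (hψ : ψ ≠ 1) (e : Fin d → F) (v : V) :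
    ∑ u, P ρ ψ e u v = (Fintype.card F : k) ^ d • v := by
  simp only [P_apply]
  rw [Finset.sum_comm, Finset.sum_eq_single 0]
  · simp [T_zero_right]
    rw [← Nat.cast_smul_eq_nsmul k]
    simp
  · intro χ _ hχ
    rw [← Finset.sum_smul]
    have := sum_dot hψ (χ := -χ.1) (by simpa using hχ)
    simp only [neg_dotProduct] at this
    rw [this, zero_smul]
  · simp

theorem exists_ind_E_ne_bot (hq : (Fintype.card F : k) ≠ 0) (hψ : ψ ≠ 1) (hρ : ρ ≠ 1) :
    ∃ e u : Fin d → F, Ind e u ∧ E ρ ψ e u ≠ ⊥ := by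
  by_contra! H
  apply hρ
  have hT : ∀ e χ : Fin d → F, χ ⬝ᵥ e = 0 → ρ (T e χ) = 1 := by
    intro e χ h
    rcases eq_or_ne e 0 with rfl | he
    · rw [T_zero_left, map_one]
    ext v
    have hv : v ∈ E ρ ψ e 0 := by
      have h1 : (Fintype.card F : k) ^ d • v ∈ E ρ ψ e 0 := by
        rw [← sum_P hψ e]
        refine Submodule.sum_mem _ fun u _ => ?_
        by_cases hu : u ∈ F ∙ e
        · obtain ⟨c, rfl⟩ := Submodule.mem_span_singleton.1 hu
          simpa using mem_E_add (P_mem (ρ := ρ) (ψ := ψ) e (c • e) v) (-c)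
        · have := P_mem (ρ := ρ) (ψ := ψ) e u v
          rw [H e u ⟨he, hu⟩] at this
          rw [(Submodule.mem_bot k).1 this]
          exact zero_mem _
      exact (Submodule.smul_mem_iff _ (pow_ne_zero d hq)).1 h1
    rw [hv χ h]; simp
  ext1 g
  have hg : g ∈ TV (⊥ : Submodule F (Fin d → F)) := mem_TV_of_fix (by simp)
  induction hg using Subgroup.closure_induction with
  | mem g h =>
    obtain ⟨x, φ, hx, hp, rfl⟩ := h
    exact hT x φ hx
  | one => simp
  | mul g h _ _ hg hh => rw [map_mul, hg, hh]; simp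
  | inv g _ hg =>
    have : ρ g⁻¹ * ρ g = 1 := by rw [← map_mul, inv_mul_cancel, map_one]
    rw [hg] at this
    simpa using this


theorem sum_finrank_le [FiniteDimensional k V] {ι : Type*} [Fintype ι] {p : ι → Submodule k V}
    {Q : ι → V →ₗ[k] V} {c : k} (hc : c ≠ 0) (h1 : ∀ i, ∀ v ∈ p i, Q i v = c • v)
    (h2 : ∀ i j, i ≠ j → ∀ v ∈ p j, Q i v = 0) :
    ∑ i, Module.finrank k (p i) ≤ Module.finrank k V := by
  classical
  rw [← Module.finrank_pi_fintype]
  refine LinearMap.finrank_le_finrank_of_injective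
    (f := ∑ i, (p i).subtype ∘ₗ LinearMap.proj i) ?_
  rw [← LinearMap.ker_eq_bot, LinearMap.ker_eq_bot']
  intro x hx
  ext i
  have h3 := congrArg (Q i) hx
  simp only [LinearMap.sum_apply, map_sum, map_zero, LinearMap.comp_apply,
    LinearMap.proj_apply, Submodule.subtype_apply] at h3
  rw [Finset.sum_eq_single i, h1 i _ (x i).2] at h3
  · simpa [hc] using h3
  · intro j _ hj
    exact h2 i j hj.symm _ (x j).2
  · simp

theorem finrank_bound [FiniteDimensional k V] (hd : 3 ≤ d) (hq : (Fintype.card F : k) ≠ 0)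
    (hψ : ψ ≠ 1) {e u : Fin d → F} (h : Ind e u) :
    Module.finrank k (E ρ ψ e u) * (Fintype.card F ^ (d - 1) - 1) + Module.finrank k (E ρ ψ e 0) ≤
      Module.finrank k V := by
  classical
  obtain ⟨φ, h1⟩ : ∃ φ : Fin d → F, φ ⬝ᵥ e = 1 := by
    obtain ⟨φ, _, h1⟩ := exists_sep ⊥ (y := e) (by simpa using h.1)
    exact ⟨φ, h1⟩
  have hφ : φ ≠ 0 := by rintro rfl; simp at h1
  have hcφ : Fintype.card (perp φ) = Fintype.card F ^ (d - 1) := by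
    rw [card_perp]
    congr 1
    have := finrank_perp hφ
    omega
  have hce : (Fintype.card (perp e) : k) ≠ 0 := by
    rw [card_perp, Nat.cast_pow]; exact pow_ne_zero _ hq
  have hdis : ∀ a b : perp φ, a ≠ b → a.1 - b.1 ∉ F ∙ e := by
    intro a b hab hm
    obtain ⟨c, hc⟩ := Submodule.mem_span_singleton.1 hm
    have h2 := congrArg (fun z => φ ⬝ᵥ z) hc
    have ha := a.2
    have hb := b.2
    rw [mem_perp, dotProduct_comm] at ha hb
    simp only [dotProduct_smul, h1, dotProduct_sub, ha, hb] at h2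
    simp at h2
    rw [h2, zero_smul] at hc
    exact hab (Subtype.ext (sub_eq_zero.1 hc.symm))
  have h4 := sum_finrank_le (p := fun a : perp φ => E ρ ψ e a.1) (Q := fun a => P ρ ψ e a.1) hce
    (fun a v hv => P_of_mem hv) (fun a b hab v hv => P_of_mem_ne hψ hv (hdis b a hab.symm))
  have h5 : ∀ a ∈ Finset.univ.erase (0 : perp φ),
      Module.finrank k (E ρ ψ e a.1) = Module.finrank k (E ρ ψ e u) := by
    intro a ha
    refine finrank_E_eq hd ⟨h.1, ?_⟩ h
    have := hdis a 0 (Finset.ne_of_mem_erase ha)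
    rwa [Submodule.coe_zero, sub_zero] at this
  have h6 : Module.finrank k (E ρ ψ e (0 : perp φ).1) = Module.finrank k (E ρ ψ e 0) := by
    rw [Submodule.coe_zero]
  rw [← Finset.sum_erase_add _ _ (Finset.mem_univ (0 : perp φ)),
    Finset.sum_congr rfl h5, h6, Finset.sum_const,
    Finset.card_erase_of_mem (Finset.mem_univ _), Finset.card_univ, hcφ, smul_eq_mul,
    mul_comm] at h4
  exact h4

end Fintype
end

section

variable {F : Type*} [Field F] {d : ℕ} {k : Type*} [Field k]
  {V : Type*} [AddCommGroup V] [Module k V]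
  {ρ : Representation k (SL d F) V} {ψ : AddChar F k}

/-- The pointwise stabilizer of `e, u` (generated by transvections) acts trivially on `E e u`. -/
def StabTrivial (ρ : Representation k (SL d F) V) (ψ : AddChar F k) : Prop :=
  ∀ e u : Fin d → F, Ind e u → ∀ x χ : Fin d → F, χ ⬝ᵥ e = 0 → χ ⬝ᵥ u = 0 → χ ⬝ᵥ x = 0 →
    ∀ v ∈ E ρ ψ e u, ρ (T x χ) v = v

/-- `g` acts as a scalar on `p`. -/
def ActsScalar (ρ : Representation k (SL d F) V) (p : Submodule k V) (g : SL d F) : Prop :=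
  ∃ c : k, ∀ v ∈ p, ρ g v = c • v

theorem actsScalar_of_finrank_one {p : Submodule k V} (hp : Module.finrank k p = 1) {g : SL d F}
    (hg : ∀ v ∈ p, ρ g v ∈ p) : ActsScalar ρ p g := by
  obtain ⟨w, hw, hspan⟩ := finrank_eq_one_iff'.1 hp
  obtain ⟨c, hc⟩ := hspan ⟨ρ g w, hg _ w.2⟩
  refine ⟨c, fun v hv => ?_⟩
  obtain ⟨b, hb⟩ := hspan ⟨v, hv⟩
  have hb' : b • w.1 = v := congrArg Subtype.val hb
  have hc' : c • w.1 = ρ g w := congrArg Subtype.val hc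
  rw [← hb', map_smul, ← hc', smul_comm]

theorem comm_trivial {p : Submodule k V} {A B : SL d F} (hA : ActsScalar ρ p A)
    (hB : ActsScalar ρ p B) : ∀ v ∈ p, ρ (A * B * A⁻¹ * B⁻¹) v = v := by
  intro v hv
  rcases eq_or_ne v 0 with rfl | hv0
  · simp
  obtain ⟨a, ha⟩ := hA
  obtain ⟨b, hb⟩ := hB
  have ha0 : a ≠ 0 := by
    rintro rfl
    exact hv0 (rho_injective (ρ := ρ) A (by rw [ha v hv]; simp))
  have hb0 : b ≠ 0 := by
    rintro rfl
    exact hv0 (rho_injective (ρ := ρ) B (by rw [hb v hv]; simp))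
  have h1 : ρ (A * B * A⁻¹ * B⁻¹) (ρ (B * A) v) = ρ (A * B) v := by
    rw [← rho_mul]; congr 2; group
  have h2 : ρ (B * A) v = (a * b) • v := by rw [rho_mul, ha v hv, map_smul, hb v hv, smul_smul]
  have h3 : ρ (A * B) v = (a * b) • v := by
    rw [rho_mul, hb v hv, map_smul, ha v hv, smul_smul, mul_comm]
  rw [h2, h3, map_smul] at h1
  exact smul_right_injective V (mul_ne_zero ha0 hb0) h1

theorem T_fix {e x χ : Fin d → F} (hx : χ ⬝ᵥ x = 0) (he : χ ⬝ᵥ e = 0) : T x χ • e = e := by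
  rw [T_smul hx, he]; simp

theorem mem_E_of_fix {e u : Fin d → F} {g : SL d F} (he : g • e = e) (hu : g • u = u) :
    ∀ v ∈ E ρ ψ e u, ρ g v ∈ E ρ ψ e u := fun v hv => by
  have := smul_mem_E g hv
  rwa [he, hu] at this

theorem T_mem_E {e u x χ : Fin d → F} (hx : χ ⬝ᵥ x = 0) (he : χ ⬝ᵥ e = 0) (hu : χ ⬝ᵥ u = 0) :
    ∀ v ∈ E ρ ψ e u, ρ (T x χ) v ∈ E ρ ψ e u :=
  mem_E_of_fix (T_fix hx he) (T_fix hx hu)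

theorem exists_comm {e u x χ : Fin d → F}
    (hd : Module.finrank F ↥(Submodule.span F {e, u, x}) + 1 < d) :
    ∃ y φ : Fin d → F, χ ⬝ᵥ y = 0 ∧ φ ⬝ᵥ e = 0 ∧ φ ⬝ᵥ u = 0 ∧ φ ⬝ᵥ x = 0 ∧ φ ⬝ᵥ y = 1 := by
  obtain ⟨y, hy, hy'⟩ : ∃ y ∈ perp χ, y ∉ Submodule.span F {e, u, x} := by
    by_contra! h
    have h1 := Submodule.finrank_mono (show perp χ ≤ Submodule.span F {e, u, x} from h)
    rcases eq_or_ne χ 0 with rfl | hχ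
    · rw [show perp (0 : Fin d → F) = ⊤ from eq_top_iff.2 fun z _ => by simp] at h1
      simp at h1
      omega
    · have := finrank_perp hχ
      omega
  obtain ⟨φ, h1, h2⟩ := exists_sep _ hy'
  refine ⟨y, φ, by rwa [mem_perp, dotProduct_comm] at hy, ?_, ?_, ?_, h2⟩ <;>
  · apply h1
    apply Submodule.subset_span
    simp

theorem trivial_of_comm {e u x χ : Fin d → F}
    (hd : Module.finrank F ↥(Submodule.span F {e, u, x}) + 1 < d)
    (he : χ ⬝ᵥ e = 0) (hu : χ ⬝ᵥ u = 0) (hx : χ ⬝ᵥ x = 0)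
    (hs : ∀ y φ : Fin d → F, φ ⬝ᵥ e = 0 → φ ⬝ᵥ u = 0 → φ ⬝ᵥ y = 0 →
      ActsScalar ρ (E ρ ψ e u) (T y φ)) : ∀ v ∈ E ρ ψ e u, ρ (T x χ) v = v := by
  obtain ⟨y, φ, h1, h2, h3, h4, h5⟩ := exists_comm (χ := χ) hd
  have := comm_T h4 hx h1
  rw [h5, one_smul] at this
  rw [← this]
  exact comm_trivial (hs _ _ h2 h3 h4) (hs _ _ he hu h1)

theorem trivial_of_torus {e u x χ : Fin d → F} (he : χ ⬝ᵥ e = 0) (hu : χ ⬝ᵥ u = 0)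
    (hx : χ ⬝ᵥ x = 0) (hs : ∀ y φ : Fin d → F, φ ⬝ᵥ e = 0 → φ ⬝ᵥ u = 0 → φ ⬝ᵥ y = 0 →
      ActsScalar ρ (E ρ ψ e u) (T y φ)) {g : SL d F} (hg : ActsScalar ρ (E ρ ψ e u) g) {c : F}
    (hc : c ≠ 1) (hgc : ∀ s : F, g * T x (s • χ) = T x ((c * s) • χ) * g) :
    ∀ v ∈ E ρ ψ e u, ρ (T x χ) v = v := by
  intro v hv
  rcases eq_or_ne v 0 with rfl | hv0
  · simp
  have hc' : c - 1 ≠ 0 := sub_ne_zero.2 hc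
  set s : F := (c - 1)⁻¹
  obtain ⟨a, ha⟩ := hg
  obtain ⟨t, ht⟩ := hs x (s • χ) (by simp [he]) (by simp [hu]) (by simp [hx])
  have ha0 : a ≠ 0 := by
    rintro rfl
    exact hv0 (rho_injective (ρ := ρ) g (by rw [ha v hv]; simp))
  have ht0 : t ≠ 0 := by
    rintro rfl
    exact hv0 (rho_injective (ρ := ρ) (T x (s • χ)) (by rw [ht v hv]; simp))
  have h1 : ρ (T x ((c * s) • χ)) v = t • v := by
    have h2 := congrArg (fun h => ρ h v) (hgc s)
    simp only [rho_mul] at h2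
    rw [ht v hv, ha v hv, map_smul, map_smul, ha v hv, smul_comm] at h2
    exact (smul_right_injective V ha0 h2).symm
  have h3 : T x ((c * s) • χ) = T x χ * T x (s • χ) := by
    rw [← T_add_right hx (by simp [hx])]
    congr 1
    rw [show c * s = 1 + s by simp only [s]; field_simp; ring, add_smul, one_smul]
  rw [h3, rho_mul, ht v hv, map_smul] at h1
  exact smul_right_injective V ht0 h1

/-- `d = 4`: a torus element fixing `e`, `u`. -/
theorem exists_torus_four {e u x χ : Fin d → F} (hχ : χ ≠ 0) (he : χ ⬝ᵥ e = 0) (hu : χ ⬝ᵥ u = 0)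
    (hx : χ ⬝ᵥ x = 0) (hxeu : x ∉ Submodule.span F {e, u}) {a : F} (ha : a ≠ 0) :
    ∃ g : SL d F, g • e = e ∧ g • u = u ∧ ∀ s : F, g * T x (s • χ) = T x ((a ^ 2 * s) • χ) * g := by
  obtain ⟨ξ, h1, h2⟩ := exists_sep _ hxeu
  have hξe : ξ ⬝ᵥ e = 0 := h1 _ (Submodule.subset_span (by simp))
  have hξu : ξ ⬝ᵥ u = 0 := h1 _ (Submodule.subset_span (by simp))
  obtain ⟨z, hz, hξz⟩ : ∃ z, χ ⬝ᵥ z = 1 ∧ ξ ⬝ᵥ z = 0 := by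
    obtain ⟨z, -, hz⟩ := exists_sep ⊥ (y := χ) (by simpa using hχ)
    rw [dotProduct_comm] at hz
    exact ⟨z - (ξ ⬝ᵥ z) • x, by simp [hz, hx], by simp [h2]⟩
  let g : SL d F := ⟨(1 + vecMulVec ((a - 1) • x) ξ) * (1 + vecMulVec ((a⁻¹ - 1) • z) χ), by
    rw [det_mul, det_one_add_vecMulVec, det_one_add_vecMulVec, dotProduct_smul, dotProduct_smul,
      h2, hz]
    simp [ha]⟩
  have hg : ∀ w, g • w = w + ((a⁻¹ - 1) * χ ⬝ᵥ w) • z + ((a - 1) * ξ ⬝ᵥ w) • x := by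
    intro w
    rw [smul_eq]
    change ((1 + vecMulVec ((a - 1) • x) ξ) * (1 + vecMulVec ((a⁻¹ - 1) • z) χ)) *ᵥ w = _
    rw [← mulVec_mulVec, add_mulVec, add_mulVec, vecMulVec_mulVec, vecMulVec_mulVec]
    simp [dotProduct_add, hξz, smul_smul, mul_comm]
  refine ⟨g, by rw [hg, he, hξe]; simp, by rw [hg, hu, hξu]; simp, fun s => ext_smul fun w => ?_⟩
  rw [mul_smul, mul_smul, T_smul (by simp [hx]), T_smul (by simp [hx]), hg, hg]
  simp only [dotProduct_add, dotProduct_smul, smul_dotProduct, hx, h2, hz, smul_eq_mul]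
  match_scalars <;> field_simp <;> ring

/-- `d = 3`: a torus element scaling `e`, `u`. -/
theorem exists_torus_three (hd : d = 3) {e u x χ : Fin d → F} (hχ : χ ≠ 0) (he : χ ⬝ᵥ e = 0)
    (hu : χ ⬝ᵥ u = 0) (hx : χ ⬝ᵥ x = 0) {a : F} (ha : a ≠ 0) :
    ∃ g : SL d F, g • e = a • e ∧ g • u = a • u ∧
      ∀ s : F, g * T x (s • χ) = T x ((a ^ 3 * s) • χ) * g := by
  obtain ⟨z, -, hz⟩ := exists_sep ⊥ (y := χ) (by simpa using hχ)
  rw [dotProduct_comm] at hz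
  let g : SL d F := ⟨a • (1 + vecMulVec ((a⁻¹ ^ 3 - 1) • z) χ), by
    rw [det_smul, det_one_add_vecMulVec, dotProduct_smul, hz, hd]
    simp [ha]⟩
  have hg : ∀ w, g • w = a • w + (a * (a⁻¹ ^ 3 - 1) * χ ⬝ᵥ w) • z := by
    intro w
    rw [smul_eq]
    change (a • (1 + vecMulVec ((a⁻¹ ^ 3 - 1) • z) χ)) *ᵥ w = _
    rw [smul_mulVec, add_mulVec, vecMulVec_mulVec]
    simp [smul_smul, mul_comm, mul_left_comm]
  refine ⟨g, by rw [hg, he]; simp, by rw [hg, hu]; simp, fun s => ext_smul fun w => ?_⟩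
  rw [mul_smul, mul_smul, T_smul (by simp [hx]), T_smul (by simp [hx]), hg, hg]
  simp only [dotProduct_add, dotProduct_smul, smul_dotProduct, hx, hz, smul_eq_mul]
  match_scalars <;> field_simp <;> ring

theorem exists_pow_ne_one [Fintype F] {m : ℕ} (hm : 0 < m) (hq : m + 1 < Fintype.card F) :
    ∃ a : F, a ≠ 0 ∧ a ^ m ≠ 1 := by
  classical
  by_contra! h
  have h1 : (Finset.univ.erase (0 : F)) ⊆ (Polynomial.nthRootsFinset m (1 : F)) := by
    intro a ha
    rw [Polynomial.mem_nthRootsFinset hm]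
    exact h a (Finset.ne_of_mem_erase ha)
  have h2 := Finset.card_le_card h1
  rw [Finset.card_erase_of_mem (Finset.mem_univ _), Finset.card_univ] at h2
  have h3 : (Polynomial.nthRootsFinset m (1 : F)).card ≤ m := by
    rw [Polynomial.nthRootsFinset]
    exact (Multiset.toFinset_card_le _).trans (Polynomial.card_nthRoots m 1)
  omega

theorem stabTrivial_of_finrank_one [Fintype F] (hd : 3 ≤ d)
    (h1 : ∀ e u : Fin d → F, Ind e u → Module.finrank k (E ρ ψ e u) = 1)
    (h3 : d = 3 → 4 < Fintype.card F) (h4 : d = 4 → 3 < Fintype.card F) : StabTrivial ρ ψ := by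
  intro e u h x χ he hu hx v hv
  have hs : ∀ y φ : Fin d → F, φ ⬝ᵥ e = 0 → φ ⬝ᵥ u = 0 → φ ⬝ᵥ y = 0 →
      ActsScalar ρ (E ρ ψ e u) (T y φ) := fun y φ he hu hy =>
    actsScalar_of_finrank_one (h1 e u h) (T_mem_E hy he hu)
  rcases eq_or_ne χ 0 with rfl | hχ
  · rw [T_zero_right, map_one]; rfl
  by_cases hfr : Module.finrank F ↥(Submodule.span F {e, u, x}) + 1 < d
  · exact trivial_of_comm hfr he hu hx hs v hv
  have hd5 : d < 5 := by have := finrank_span_triple_le e u x; omega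
  rcases (by omega : d = 3 ∨ d = 4) with hd' | hd'
  · obtain ⟨a, ha, ha3⟩ := exists_pow_ne_one (F := F) (m := 3) (by simp) (h3 hd')
    obtain ⟨g, hge, hgu, hg⟩ := exists_torus_three hd' hχ he hu hx ha
    refine trivial_of_torus he hu hx hs (actsScalar_of_finrank_one (h1 e u h) (g := g) ?_) ha3 hg
      v hv
    intro v hv
    have := smul_mem_E g hv
    rwa [hge, hgu, E_smul_eq ha] at this
  · obtain ⟨a, ha, ha3⟩ := exists_pow_ne_one (F := F) (m := 2) (by simp) (h4 hd')
    have hxeu : x ∉ Submodule.span F {e, u} := by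
      intro hx
      have h2 : Submodule.span F {e, u, x} ≤ Submodule.span F {e, u} := by
        rw [Submodule.span_le]
        rintro y (rfl | rfl | rfl)
        · exact Submodule.subset_span (by simp)
        · exact Submodule.subset_span (by simp)
        · exact hx
      have := Submodule.finrank_mono h2
      have := finrank_span_pair_le e u
      omega
    obtain ⟨g, hge, hgu, hg⟩ := exists_torus_four hχ he hu hx hxeu ha
    exact trivial_of_torus he hu hx hs (actsScalar_of_finrank_one (h1 e u h) (mem_E_of_fix hge hgu))
      ha3 hg v hv

end

section

theorem matrix_two_scalar {k : Type*} [Field k] (h2 : (2 : k) ≠ 0) (M : Matrix (Fin 2) (Fin 2) k)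
    (hM : M * M = 1) (hdet : M.det = 1) : ∃ c : k, M = c • 1 := by
  have h00 := congrFun (congrFun hM 0) 0
  have h01 := congrFun (congrFun hM 0) 1
  have h10 := congrFun (congrFun hM 1) 0
  simp [mul_apply, Fin.sum_univ_two] at h00 h01 h10
  rw [det_fin_two] at hdet
  have htr : M 0 0 + M 1 1 ≠ 0 := by
    intro h
    apply h2
    linear_combination (M 0 0) * h - hdet - h00
  have hb : M 0 1 = 0 := by
    have : M 0 1 * (M 0 0 + M 1 1) = 0 := by linear_combination h01
    simpa [htr] using this
  have hc : M 1 0 = 0 := by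
    have : M 1 0 * (M 0 0 + M 1 1) = 0 := by linear_combination h10
    simpa [htr] using this
  have ha : M 0 0 ≠ 0 := by
    intro h; rw [h, hb] at h00; simp at h00
  have hd : M 1 1 = M 0 0 := by
    apply mul_left_cancel₀ ha
    linear_combination hdet - h00 + 2 * M 0 1 * hc
  refine ⟨M 0 0, ?_⟩
  ext i j
  fin_cases i <;> fin_cases j <;> simp [hb, hc, hd]

variable {k : Type*} [Field k]

theorem end_two_scalar {W : Type*} [AddCommGroup W] [Module k W] (h2 : (2 : k) ≠ 0)
    (hW : Module.finrank k W = 2) (s : W →ₗ[k] W) (hs : s ∘ₗ s = LinearMap.id)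
    (hdet : LinearMap.det s = 1) : ∃ c : k, ∀ w, s w = c • w := by
  have : FiniteDimensional k W := Module.finite_of_finrank_eq_succ hW
  let b := Module.finBasisOfFinrankEq k W hW
  obtain ⟨c, hc⟩ := matrix_two_scalar h2 (LinearMap.toMatrix b b s)
    (by rw [← LinearMap.toMatrix_comp, hs, LinearMap.toMatrix_id])
    (by rw [LinearMap.det_toMatrix, hdet])
  refine ⟨c, fun w => ?_⟩
  have : s = c • LinearMap.id := by
    apply (LinearMap.toMatrix b b).injective
    rw [hc, map_smul, LinearMap.toMatrix_id]
  rw [this]; rfl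

variable {F : Type*} [Field F] {d : ℕ} {V : Type*} [AddCommGroup V] [Module k V]
  {ρ : Representation k (SL d F) V} {ψ : AddChar F k}

theorem actsScalar_of_finrank_two (h2 : (2 : k) ≠ 0) {p : Submodule k V}
    (hp : Module.finrank k p = 2) {A B C : SL d F} (hA : ∀ v ∈ p, ρ A v ∈ p)
    (hB : ∀ v ∈ p, ρ B v ∈ p) (hC : ∀ v ∈ p, ρ C v ∈ p) (hCC : C * C = 1)
    (hABC : A * B * A⁻¹ * B⁻¹ = C) : ActsScalar ρ p C := by
  have : FiniteDimensional k p := Module.finite_of_finrank_eq_succ hp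
  let a := (ρ A).restrict hA
  let b := (ρ B).restrict hB
  let c := (ρ C).restrict hC
  have hcc : c ∘ₗ c = LinearMap.id := by
    ext v
    change ρ C (ρ C v) = v
    rw [← rho_mul, hCC, map_one]; rfl
  have hab : c ∘ₗ (b ∘ₗ a) = a ∘ₗ b := by
    ext v
    change ρ C (ρ B (ρ A v)) = ρ A (ρ B v)
    rw [← rho_mul, ← rho_mul, ← rho_mul, ← hABC]
    congr 2; group
  have hdet : ∀ (A : SL d F) (hA : ∀ v ∈ p, ρ A v ∈ p), LinearMap.det ((ρ A).restrict hA) ≠ 0 := by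
    intro A hA h
    obtain ⟨x, hx, h0⟩ := Submodule.exists_mem_ne_zero_of_ne_bot
      (LinearMap.bot_lt_ker_of_det_eq_zero h).ne'
    apply h0
    apply Subtype.ext
    apply rho_injective (ρ := ρ) A
    have := congrArg Subtype.val (LinearMap.mem_ker.1 hx)
    simpa using this
  have hdc : LinearMap.det c = 1 := by
    have := congrArg LinearMap.det hab
    rw [LinearMap.det_comp, LinearMap.det_comp, LinearMap.det_comp,
      mul_comm (LinearMap.det b)] at this
    exact mul_right_cancel₀ (mul_ne_zero (hdet A hA) (hdet B hB)) (by rw [this, one_mul])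
  obtain ⟨t, ht⟩ := end_two_scalar h2 hp c hcc hdc
  exact ⟨t, fun v hv => congrArg Subtype.val (ht ⟨v, hv⟩)⟩

theorem stabTrivial_of_finrank_two (h2 : (2 : k) ≠ 0) (hF : (2 : F) = 0) (hd : 5 ≤ d)
    (h : ∀ e u : Fin d → F, Ind e u → Module.finrank k (E ρ ψ e u) = 2) : StabTrivial ρ ψ := by
  intro e u heu x χ he hu hx v hv
  have hdim : ∀ x, Module.finrank F ↥(Submodule.span F {e, u, x}) + 1 < d := fun x => by
    have := finrank_span_triple_le e u x; omega
  refine trivial_of_comm (hdim x) he hu hx (fun y φ he hu hy => ?_) v hv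
  obtain ⟨z, ξ, h1, h2, h3, h4, h5⟩ := exists_comm (χ := φ) (hdim y)
  have := comm_T h4 hy h1
  rw [h5, one_smul] at this
  refine actsScalar_of_finrank_two (by assumption) (h e u heu) (T_mem_E h4 h2 h3) (T_mem_E h1 he hu)
    (T_mem_E hy he hu) ?_ this
  rw [← T_add_right hy hy, ← two_smul F, hF, zero_smul, T_zero_right]

end

section

variable {k : Type*} [Field k]
variable {F : Type*} [Field F] [Fintype F] {d : ℕ} {V : Type*} [AddCommGroup V] [Module k V]
  {ρ : Representation k (SL d F) V} {ψ : AddChar F k}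

/-- The sum of the translates of `v` under the group `{T (s • e) φ}`. -/
noncomputable def lineSum (ρ : Representation k (SL d F) V) (e φ : Fin d → F) : V →ₗ[k] V :=
  ∑ s : F, ρ (T (s • e) φ)

theorem lineSum_apply (e φ : Fin d → F) (v : V) :
    lineSum ρ e φ v = ∑ s : F, ρ (T (s • e) φ) v := by
  simp [lineSum]

theorem eq_zero_of_smul_eq {c : k} (hc : c ≠ 1) {v : V} (h : c • v = v) : v = 0 := by
  have : (c - 1) • v = 0 := by rw [sub_smul, h, one_smul, sub_self]
  simpa [sub_ne_zero.2 hc] using this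

theorem lineSum_T_self (hS : StabTrivial ρ ψ) {e f u φ : Fin d → F} (hfu : Ind f u)
    (he : φ ⬝ᵥ e = 0) (hf : φ ⬝ᵥ f = 0) (hu : φ ⬝ᵥ u = 1) {v : V} (hv : v ∈ E ρ ψ f u)
    {χ : Fin d → F} (hχe : χ ⬝ᵥ e = 0) (hχf : χ ⬝ᵥ f = 0) :
    ρ (T e χ) (lineSum ρ e φ v) = lineSum ρ e φ v := by
  set c := χ ⬝ᵥ u
  have h1 : (χ - c • φ) ⬝ᵥ e = 0 := by simp [hχe, he]
  have hfix : ρ (T e (χ - c • φ)) v = v :=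
    hS f u hfu e _ (by simp [hχf, hf]) (by simp [hu, c]) h1 v hv
  rw [lineSum_apply, map_sum]
  refine Fintype.sum_equiv (Equiv.addLeft c) _ _ fun s => ?_
  have h2 : T e χ * T (s • e) φ = T ((c + s) • e) φ * T e (χ - c • φ) := by
    rw [T_smul_smul he, T_smul_smul he, ← T_add_right hχe (by simp [he]),
      ← T_add_right (by simp [he]) h1]
    congr 1
    module
  rw [← rho_mul, h2, rho_mul, hfix]
  rfl

theorem lineSum_T_other {e f u φ : Fin d → F}
    (he : φ ⬝ᵥ e = 0) (hf : φ ⬝ᵥ f = 0) (hu : φ ⬝ᵥ u = 1) {v : V} (hv : v ∈ E ρ ψ f u)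
    {χ : Fin d → F} (hχe : χ ⬝ᵥ e = 0) (hχf : χ ⬝ᵥ f = 0) :
    ρ (T f χ) (lineSum ρ e φ v) = ψ (χ ⬝ᵥ u) • lineSum ρ e φ v := by
  rw [lineSum_apply, map_sum, Finset.smul_sum]
  refine Finset.sum_congr rfl fun s _ => ?_
  have h0 : φ ⬝ᵥ (s • e) = 0 := by simp [he]
  have := smul_mem_E (T (s • e) φ) hv
  rw [T_fix h0 hf, T_smul h0, hu, one_smul] at this
  rw [this χ hχf, dotProduct_add, dotProduct_smul, hχe, smul_zero, add_zero]

theorem lineSum_injective (hψ : ψ ≠ 1) (hq : (Fintype.card F : k) ≠ 0) {e f u φ : Fin d → F}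
    (hfe : Ind f e) (he : φ ⬝ᵥ e = 0) (hf : φ ⬝ᵥ f = 0) (hu : φ ⬝ᵥ u = 1)
    {v : V} (hv : v ∈ E ρ ψ f u) (h0 : lineSum ρ e φ v = 0) : v = 0 := by
  have h1 := congrArg (P ρ ψ f u) h0
  rw [lineSum_apply, map_sum, map_zero, Finset.sum_eq_single 0, zero_smul, T_zero_left,
    map_one] at h1
  · have h2 : P ρ ψ f u v = 0 := h1
    rw [P_of_mem hv, card_perp, Nat.cast_pow] at h2
    simpa [hq] using h2
  · intro s _ hs
    have h0 : φ ⬝ᵥ (s • e) = 0 := by simp [he]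
    have := smul_mem_E (T (s • e) φ) hv
    rw [T_fix h0 hf, T_smul h0, hu, one_smul] at this
    refine P_of_mem_ne hψ this ?_
    rw [add_sub_cancel_left]
    exact (hfe.smul_right hs).2
  · simp

theorem mem_E_zero_of (hS : StabTrivial ρ ψ) (hψ : ψ ≠ 1) (hq : (Fintype.card F : k) ≠ 0)
    {e f u φ : Fin d → F} (hef : Ind e f) (he : φ ⬝ᵥ e = 0) (hf : φ ⬝ᵥ f = 0) (hu : φ ⬝ᵥ u = 1)
    {x : V} (ha : ∀ χ, χ ⬝ᵥ e = 0 → χ ⬝ᵥ f = 0 → ρ (T e χ) x = x)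
    (hb : ∀ χ, χ ⬝ᵥ e = 0 → χ ⬝ᵥ f = 0 → ρ (T f χ) x = ψ (χ ⬝ᵥ u) • x) : x ∈ E ρ ψ e 0 := by
  obtain ⟨t, ht⟩ := AddChar.ne_one_iff.1 hψ
  suffices h : ∀ w, P ρ ψ e w x ∈ E ρ ψ e 0 by
    have h1 : (Fintype.card F : k) ^ d • x ∈ E ρ ψ e 0 := by
      rw [← sum_P hψ e]
      exact Submodule.sum_mem _ fun w _ => h w
    exact (Submodule.smul_mem_iff _ (pow_ne_zero d hq)).1 h1
  intro w
  have hPb : ∀ χ, χ ⬝ᵥ e = 0 → χ ⬝ᵥ f = 0 →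
      ρ (T f χ) (P ρ ψ e w x) = ψ (χ ⬝ᵥ u) • P ρ ψ e w x := by
    intro χ h1 h2
    rw [P_apply, map_sum, Finset.smul_sum]
    refine Finset.sum_congr rfl fun ξ _ => ?_
    have hξ := ξ.2
    rw [mem_perp] at hξ
    have h3 : T f χ * T e ξ.1 = T e ξ.1 * (T f χ * T e ((-(ξ.1 ⬝ᵥ f)) • χ)) := by
      have h4 := mul_T (T e ξ.1) (x := f + (-(ξ.1 ⬝ᵥ f)) • e) (φ := χ) (by simp [h1, h2])
      rw [ct_T_smul hξ, T_smul hξ, h1, T_add_left h2 (by simp [h1]), T_smul_smul h1] at h4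
      rw [h4]
      congr 2
      · simp [hξ]
      · simp
    rw [map_smul, ← rho_mul, h3, rho_mul, rho_mul, ha _ (by simp [h1]) (by simp [h2]),
      hb χ h1 h2, map_smul, smul_comm]
  by_cases hw : w ∈ Submodule.span F {e, f}
  · obtain ⟨a, c, rfl⟩ := Submodule.mem_span_pair.1 hw
    have hy : P ρ ψ e (a • e + c • f) x ∈ E ρ ψ e (c • f) := by
      have := mem_E_add (P_mem (ρ := ρ) (ψ := ψ) e (a • e + c • f) x) (-a)
      rwa [show a • e + c • f + (-a) • e = c • f by module] at this
    rcases eq_or_ne c 0 with hc | hc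
    · rw [hc, zero_smul] at hy
      rw [hc, zero_smul]
      exact hy
    · have h1 := hS e (c • f) (hef.smul_right hc) f (t • φ) (by simp [he]) (by simp [hf])
        (by simp [hf]) _ hy
      rw [hPb _ (by simp [he]) (by simp [hf])] at h1
      rw [eq_zero_of_smul_eq (by simpa [hu] using ht) h1]
      exact zero_mem _
  · obtain ⟨ξ, h1, h2⟩ := exists_sep _ hw
    have hξe : ξ ⬝ᵥ e = 0 := h1 _ (Submodule.subset_span (by simp))
    have hξf : ξ ⬝ᵥ f = 0 := h1 _ (Submodule.subset_span (by simp))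
    have h3 := P_T (ρ := ρ) (ψ := ψ) (u := w) (χ := t • ξ) (e := e) (by simp [hξe]) x
    rw [ha _ (by simp [hξe]) (by simp [hξf])] at h3
    rw [eq_zero_of_smul_eq (by simpa [h2] using ht) h3.symm]
    exact zero_mem _

theorem finrank_E_le_zero [FiniteDimensional k V] (hd : 3 ≤ d) (hS : StabTrivial ρ ψ) (hψ : ψ ≠ 1)
    (hq : (Fintype.card F : k) ≠ 0) : ∃ e f u : Fin d → F, e ≠ 0 ∧ Ind f u ∧
      Module.finrank k (E ρ ψ f u) ≤ Module.finrank k (E ρ ψ e 0) := by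
  obtain ⟨e, f, hef⟩ := exists_ind (F := F) (d := d) (by omega)
  obtain ⟨u, hu⟩ := exists_notMem (p := Submodule.span F {e, f})
    (by have := finrank_span_pair_le e f; omega)
  obtain ⟨φ, h1, h2⟩ := exists_sep _ hu
  have he : φ ⬝ᵥ e = 0 := h1 _ (Submodule.subset_span (by simp))
  have hf : φ ⬝ᵥ f = 0 := h1 _ (Submodule.subset_span (by simp))
  have hfu : Ind f u := ind_of_dot hef.right_ne hf (by simp [h2])
  refine ⟨e, f, u, hef.1, hfu, ?_⟩
  refine LinearMap.finrank_le_finrank_of_injective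
    (f := (lineSum ρ e φ).restrict (p := E ρ ψ f u) (q := E ρ ψ e 0) fun v hv => ?_) ?_
  · exact mem_E_zero_of hS hψ hq hef he hf h2
      (fun χ h3 h4 => lineSum_T_self hS hfu he hf h2 hv h3 h4)
      (fun χ h3 h4 => lineSum_T_other he hf h2 hv h3 h4)
  · rw [← LinearMap.ker_eq_bot, LinearMap.ker_eq_bot']
    intro v hv
    apply Subtype.ext
    exact lineSum_injective hψ hq hef.symm he hf h2 v.2 (congrArg Subtype.val hv)

/-- The parameters to which the argument applies. -/
structure Good (d q n : ℕ) : Prop where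
  three_le : 3 ≤ d
  two_le : 2 ≤ q
  three : d = 3 → 4 < q
  four : d = 4 → 3 < q
  bound : n * (q - 1) ≤ q ^ d - 1

theorem finrank_E_eq_one [FiniteDimensional k V] (hq : (Fintype.card F : k) ≠ 0) (hψ : ψ ≠ 1)
    (hρ : ρ ≠ 1) (hg : Good d (Fintype.card F) (Module.finrank k V)) {e u : Fin d → F}
    (h : Ind e u) : Module.finrank k (E ρ ψ e u) = 1 := by
  obtain ⟨hd, hq2, h3, h4, hn⟩ := hg
  obtain ⟨e0, u0, h0, hne⟩ := exists_ind_E_ne_bot hq hψ hρ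
  set m := Module.finrank k (E ρ ψ e u) with hm
  have hmm : ∀ e' u' : Fin d → F, Ind e' u' → Module.finrank k (E ρ ψ e' u') = m :=
    fun e' u' h' => finrank_E_eq hd h' h
  have hm0 : m ≠ 0 := by
    rw [← hmm e0 u0 h0]
    intro h
    exact hne (Submodule.finrank_eq_zero.1 h)
  have hb : m * (Fintype.card F ^ (d - 1) - 1) + 0 ≤ Module.finrank k V :=
    (Nat.add_le_add_left (Nat.zero_le _) _).trans (finrank_bound hd hq hψ h)
  set q := Fintype.card F with hqdef
  obtain ⟨r, rfl⟩ : ∃ r, d = r + 1 := ⟨d - 1, by omega⟩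
  simp only [Nat.add_sub_cancel] at hb
  have hqr : q ^ 2 ≤ q ^ r := Nat.pow_le_pow_right (by omega) (by omega)
  have hq4 : 2 ^ 2 ≤ q ^ 2 := Nat.pow_le_pow_left hq2 2
  have hb' : m * (q ^ r - 1) * (q - 1) ≤ q ^ r * q - 1 := by
    rw [← pow_succ]; exact (Nat.mul_le_mul_right _ (by omega)).trans hn
  obtain ⟨Q, hQ⟩ : ∃ Q, q ^ r = Q + 1 := ⟨q ^ r - 1, by omega⟩
  obtain ⟨s, hs⟩ : ∃ s, q = s + 2 := ⟨q - 2, by omega⟩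
  rw [hQ, hs] at hb'
  simp only [Nat.add_sub_cancel, show s + 2 - 1 = s + 1 by omega] at hb'
  have hb2 : m * Q * (s + 1) + 1 ≤ (Q + 1) * (s + 2) := by
    have : 0 < (Q + 1) * (s + 2) := by positivity
    omega
  have hQ3 : (s + 2) ^ 2 ≤ Q + 1 := by rw [← hQ, ← hs]; exact hqr
  by_contra hm1
  have hm2 : 2 ≤ m := by omega
  rcases Nat.eq_zero_or_pos s with rfl | hs0
  · have hr4 : 4 ≤ r := by
      by_contra hr
      have : r = 2 ∨ r = 3 := by omega
      rcases this with rfl | rfl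
      · have := h3 rfl; omega
      · have := h4 rfl; omega
    have hm3 : m = 2 := by
      by_contra hm3
      have : 3 ≤ m := by omega
      have h16 : 2 ^ 4 ≤ Q + 1 := by
        rw [← hQ, hs]; exact Nat.pow_le_pow_right (by omega) hr4
      have := Nat.mul_le_mul_right Q this
      omega
    have hF2 : (2 : F) = 0 := by
      have := Nat.cast_card_eq_zero F
      rw [← hqdef, hs] at this
      exact_mod_cast this
    have hk2 : (2 : k) ≠ 0 := by
      rw [hs] at hq
      exact_mod_cast hq
    have hS : StabTrivial ρ ψ := stabTrivial_of_finrank_two hk2 hF2 (by omega)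
      fun e u h => (hmm e u h).trans hm3
    obtain ⟨e1, f1, u1, he0, hi, hle⟩ := finrank_E_le_zero (d := r + 1) (by omega) hS hψ hq
    rw [hmm _ _ hi] at hle
    have hfin : m * Q + m ≤ Module.finrank k V := by
      obtain ⟨w, hw⟩ := exists_notMem (F := F) (d := r + 1) (p := F ∙ e1)
        (((finrank_span_le_card _).trans (by simp) : _ ≤ 1).trans_lt (by omega))
      have := finrank_bound (ρ := ρ) hd hq hψ (e := e1) (u := w) ⟨he0, hw⟩
      rw [hmm _ _ ⟨he0, hw⟩, ← hqdef, Nat.add_sub_cancel, hQ, Nat.add_sub_cancel] at this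
      omega
    rw [hs] at hn
    rw [pow_succ, ← hs, hQ, hs] at hn
    rw [hm3] at hfin
    omega
  · have : 2 * (Q * (s + 1)) ≤ m * Q * (s + 1) := by
      rw [← mul_assoc]; gcongr
    nlinarith

end

section

variable {k : Type*} [Field k]
variable {F : Type*} [Field F] {d : ℕ} {V : Type*} [AddCommGroup V] [Module k V]
  {ρ : Representation k (SL d F) V} {ψ : AddChar F k}

theorem StabTrivial.fix (hS : StabTrivial ρ ψ) {e u : Fin d → F} (h : Ind e u) {g : SL d F}
    (he : g • e = e) (hu : g • u = u) {v : V} (hv : v ∈ E ρ ψ e u) : ρ g v = v := by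
  have hg := mem_TV_of_fix (fix_span_pair he hu)
  clear he hu
  induction hg using Subgroup.closure_induction with
  | mem x hx =>
    obtain ⟨x, φ, h0, h1, rfl⟩ := hx
    exact hS e u h x φ (h1 _ (Submodule.subset_span (by simp)))
      (h1 _ (Submodule.subset_span (by simp))) h0 v hv
  | one => simp
  | mul a b _ _ ha hb => rw [rho_mul, hb, ha]
  | inv a _ ha => exact rho_injective a (by rw [rho_inv', ha])

theorem exists_w [FiniteDimensional k V] (hd : 3 ≤ d) {σ : Representation k (SL d F) V}
    (h1 : ∀ e u : Fin d → F, Ind e u → Module.finrank k (E σ ψ e u) = 1) (hS : StabTrivial σ ψ) :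
    ∃ (α : Fˣ →* k) (w : (Fin d → F) → (Fin d → F) → V),
      (∀ φ η, Ind φ η → w φ η ≠ 0) ∧ (∀ g φ η, σ g (w φ η) = w (g • φ) (g • η)) ∧
      (∀ φ η t, w φ (η + t • φ) = ψ t • w φ η) ∧
      ∀ φ η (c : Fˣ), w ((c : F) • φ) ((c : F) • η) = α c • w φ η := by
  classical
  obtain ⟨φ0, η0, h0⟩ := exists_ind (F := F) (d := d) (by omega)
  obtain ⟨⟨w0, hw0⟩, hne, hspan⟩ := finrank_eq_one_iff'.1 (h1 φ0 η0 h0)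
  replace hne : w0 ≠ 0 := fun h => hne (Subtype.ext h)
  have hspan : ∀ v ∈ E σ ψ φ0 η0, ∃ c : k, v = c • w0 := fun v hv => by
    obtain ⟨c, hc⟩ := hspan ⟨v, hv⟩
    exact ⟨c, (congrArg Subtype.val hc).symm⟩
  let w : (Fin d → F) → (Fin d → F) → V := fun φ η =>
    if h : Ind φ η then σ (trans_ind hd h0 h).choose w0 else 0
  have key : ∀ g, w (g • φ0) (g • η0) = σ g w0 := fun g => by
    have h := h0.smul g
    simp only [w, dif_pos h]
    obtain ⟨ha, hb⟩ := (trans_ind hd h0 h).choose_spec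
    set g' := (trans_ind hd h0 h).choose
    refine rho_injective (ρ := σ) g⁻¹ ?_
    rw [rho_inv, ← rho_mul]
    exact hS.fix h0 (by rw [mul_smul, ha, inv_smul_smul]) (by rw [mul_smul, hb, inv_smul_smul]) hw0
  have hw_not : ∀ φ η, ¬ Ind φ η → w φ η = 0 := fun φ η h => by simp only [w, dif_neg h]
  have hex : ∀ c : Fˣ, ∃ a : k, w ((c : F) • φ0) ((c : F) • η0) = a • w0 := fun c => by
    obtain ⟨g, ha, hb⟩ := trans_ind hd h0 ((h0.smul_left c.ne_zero).smul_right c.ne_zero)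
    rw [← ha, ← hb, key]
    apply hspan
    have := smul_mem_E g hw0
    rwa [ha, hb, E_smul_eq c.ne_zero] at this
  choose α hα using hex
  have hsc : ∀ φ η (c : Fˣ), w ((c : F) • φ) ((c : F) • η) = α c • w φ η := by
    intro φ η c
    by_cases h : Ind φ η
    · obtain ⟨g, rfl, rfl⟩ := trans_ind hd h0 h
      obtain ⟨g', ha, hb⟩ := trans_ind hd h0 ((h0.smul_left c.ne_zero).smul_right c.ne_zero)
      rw [← smul_comm g (c : F), ← smul_comm g (c : F), ← ha, ← hb, ← mul_smul, ← mul_smul, key, key,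
        rho_mul,
        ← key g', ha, hb, hα, map_smul]
    · rw [hw_not _ _ h, hw_not, smul_zero]
      intro h'
      apply h
      have := (h'.smul_left c⁻¹.ne_zero).smul_right c⁻¹.ne_zero
      simpa [smul_smul] using this
  have hbase : w φ0 η0 = w0 := by simpa using key 1
  refine ⟨⟨⟨α, ?_⟩, ?_⟩, w, ?_, ?_, ?_, hsc⟩
  · refine smul_left_injective k hne ?_
    simpa [hbase] using (hα 1).symm
  · intro c c'
    refine smul_left_injective k hne ?_
    change α (c * c') • w0 = (α c * α c') • w0
    rw [← hα, Units.val_mul, mul_smul, mul_smul, hsc, hα, smul_smul]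
  · intro φ η h
    obtain ⟨g, rfl, rfl⟩ := trans_ind hd h0 h
    rw [key]
    intro h
    exact hne (rho_injective (ρ := σ) g (by rw [h, map_zero]))
  · intro g φ η
    by_cases h : Ind φ η
    · obtain ⟨g', rfl, rfl⟩ := trans_ind hd h0 h
      rw [key, ← mul_smul, ← mul_smul, key, rho_mul]
    · rw [hw_not _ _ h, hw_not, map_zero]
      intro h'
      apply h
      simpa using h'.smul g⁻¹
  · intro φ η t
    by_cases h : Ind φ η
    · obtain ⟨g, rfl, rfl⟩ := trans_ind hd h0 h
      obtain ⟨χ, hχ0, hχ1⟩ := h0.exists_sep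
      have h2 : (t • χ) ⬝ᵥ φ0 = 0 := by simp [hχ0]
      have h3 : T φ0 (t • χ) • φ0 = φ0 := T_fix h2 h2
      have h4 : T φ0 (t • χ) • η0 = η0 + t • φ0 := by rw [T_smul h2]; simp [hχ1]
      have h5 := key (g * T φ0 (t • χ))
      rw [mul_smul, mul_smul, h3, h4, smul_add, smul_comm g t] at h5
      rw [h5, rho_mul, hw0 _ h2, map_smul, key]
      simp [hχ1]
    · rw [hw_not _ _ h, hw_not, smul_zero]
      intro h'
      apply h
      have := h'.add_smul (-t)
      rwa [show η + t • φ + (-t) • φ = η by module] at this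

variable [Fintype F]

open Classical in
/-- The partial Fourier transform, along an affine hyperplane, of a family of vectors indexed by
pairs of covectors. -/
noncomputable def z (ψ : AddChar F k) (w : (Fin d → F) → (Fin d → F) → V) (φ e u : Fin d → F) : V :=
  ∑ η with η ⬝ᵥ e = -1, ψ (-(η ⬝ᵥ u)) • w φ η

/-- An equivariant family of vectors indexed by pairs of covectors, transforming through the
character `α` under scaling. -/
structure WSys (ρ : Representation k (SL d F) V) (ψ : AddChar F k) (α : Fˣ →* k)
    (w : (Fin d → F) → (Fin d → F) → V) : Prop where
  equiv : ∀ g φ η, ρ g (w φ η) = w (ct g • φ) (ct g • η)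
  shift : ∀ φ η t, w φ (η + t • φ) = ψ t • w φ η
  scale : ∀ φ η (c : Fˣ), w ((c : F) • φ) ((c : F) • η) = α c • w φ η
  indep : ∀ e u φ φ', φ ⬝ᵥ e = 0 → φ ⬝ᵥ u = 1 → φ' ⬝ᵥ e = 0 → φ' ⬝ᵥ u = 1 →
    z ψ w φ e u = z ψ w φ' e u

theorem z_equiv {w : (Fin d → F) → (Fin d → F) → V}
    (hw : ∀ g φ η, ρ g (w φ η) = w (ct g • φ) (ct g • η)) (g : SL d F) (φ e u : Fin d → F) :
    ρ g (z ψ w φ e u) = z ψ w (ct g • φ) (g • e) (g • u) := by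
  rw [z, z, map_sum]
  refine Finset.sum_equiv (MulAction.toPerm (ct g)) (fun η => ?_) fun η _ => ?_
  · simp [ct_dot_smul]
  · rw [map_smul, hw, MulAction.toPerm_apply, ct_dot_smul]

theorem z_mem {w : (Fin d → F) → (Fin d → F) → V}
    (hw : ∀ g φ η, ρ g (w φ η) = w (ct g • φ) (ct g • η)) {φ e : Fin d → F} (u : Fin d → F)
    (hφ : φ ⬝ᵥ e = 0) : z ψ w φ e u ∈ E ρ ψ e u := by
  intro χ hχ
  rw [z, map_sum, Finset.smul_sum]
  refine Finset.sum_equiv (Equiv.addRight χ) (fun η => ?_) fun η hη => ?_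
  · simp [hχ]
  · replace hη : η ⬝ᵥ e = -1 := by simpa using hη
    rw [map_smul, hw, ct_T_smul hχ, ct_T_smul hχ, hφ, hη, smul_smul, ← AddChar.map_add_eq_mul]
    simp only [Equiv.coe_addRight, add_dotProduct]
    congr 2
    · ring
    · simp
    · simp

theorem exists_wsys [FiniteDimensional k V] (hq : (Fintype.card F : k) ≠ 0) (hψ : ψ ≠ 1)
    (hρ : ρ ≠ 1) (hg : Good d (Fintype.card F) (Module.finrank k V)) :
    ∃ (α : Fˣ →* k) (w : (Fin d → F) → (Fin d → F) → V),
      (∀ φ η, Ind φ η → w φ η ≠ 0) ∧ WSys ρ ψ α w := by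
  let σ : Representation k (SL d F) V := MonoidHom.comp ρ ct
  have hσ : ∀ g, σ (ct g) = ρ g := fun g => by simp [σ, ct_ct]
  have hσ1 : σ ≠ 1 := fun h => hρ (MonoidHom.ext fun g => by rw [← hσ, h]; rfl)
  have h1 : ∀ {τ : Representation k (SL d F) V}, τ ≠ 1 → StabTrivial τ ψ := fun {τ} hτ =>
    stabTrivial_of_finrank_one hg.three_le (fun e u => finrank_E_eq_one hq hψ hτ hg) hg.three
      hg.four
  obtain ⟨α, w, hne, he, hsh, hsc⟩ :=
    exists_w hg.three_le (fun e u => finrank_E_eq_one hq hψ hσ1 hg) (h1 hσ1)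
  have he' : ∀ g φ η, ρ g (w φ η) = w (ct g • φ) (ct g • η) := fun g φ η => by rw [← hσ, he]
  refine ⟨α, w, hne, he', hsh, hsc, fun e u φ φ' h1e h1u h2e h2u => ?_⟩
  rcases eq_or_ne e 0 with rfl | he0
  · simp [z]
  have hI : Ind e u := ind_of_dot he0 h1e (by simp [h1u])
  have hχ : (φ - φ') ⬝ᵥ u = 0 := by simp [h1u, h2u]
  have hχe : (φ - φ') ⬝ᵥ e = 0 := by simp [h1e, h2e]
  have h3 := h1 hρ e u hI u (φ - φ') hχe hχ hχ _ (z_mem he' u h1e)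
  rw [z_equiv he', T_fix hχ hχe, T_fix hχ hχ, ct_T_smul hχ, h1u, one_smul, sub_sub_cancel] at h3
  exact h3.symm

end

section

theorem mem_span_of_mem {F : Type*} [Field F] {d : ℕ} {φ e e0 y : Fin d → F}
    (he : φ ⬝ᵥ e = 0) (hy : φ ⬝ᵥ y = 1)
    (h : y ∈ Submodule.span F {e, e0}) : e0 ∈ Submodule.span F {e, y} := by
  obtain ⟨a, b, rfl⟩ := Submodule.mem_span_pair.1 h
  have hb : b ≠ 0 := by rintro rfl; simp [he] at hy
  refine Submodule.mem_span_pair.2 ⟨-b⁻¹ * a, b⁻¹, ?_⟩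
  rw [smul_add, smul_smul, smul_smul, inv_mul_cancel₀ hb]
  module

variable {k : Type*} [Field k]
variable {F : Type*} [Field F] [Fintype F] {d : ℕ} {V : Type*} [AddCommGroup V] [Module k V]
  {ρ : Representation k (SL d F) V} {ψ : AddChar F k} {α : Fˣ →* k}
  {w : (Fin d → F) → (Fin d → F) → V}

namespace WSys

theorem z_smul (H : WSys ρ ψ α w) (φ e u : Fin d → F) (a : Fˣ) :
    z ψ w φ ((a : F) • e) ((a : F) • u) = α a⁻¹ • z ψ w ((a : F) • φ) e u := by
  rw [z, z, Finset.smul_sum]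
  refine Finset.sum_equiv (MulAction.toPerm a) (fun η => ?_) fun η _ => ?_
  · simp [Units.smul_def]
  · have := H.scale ((a : F) • φ) ((a : F) • η) a⁻¹
    rw [smul_smul, smul_smul, Units.inv_mul, one_smul, one_smul] at this
    rw [this, smul_comm, MulAction.toPerm_apply, Units.smul_def, dotProduct_smul, smul_dotProduct]

theorem z_eq_zero (H : WSys ρ ψ α w) (hψ : ψ ≠ 1) {φ e u : Fin d → F} (he : φ ⬝ᵥ e = 0)
    (hu : φ ⬝ᵥ u ≠ 1) : z ψ w φ e u = 0 := by
  obtain ⟨t, ht⟩ := AddChar.ne_one_iff.1 hψ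
  obtain ⟨s, hst⟩ : ∃ s, s * (φ ⬝ᵥ u - 1) = t :=
    ⟨t / (φ ⬝ᵥ u - 1), div_mul_cancel₀ _ (sub_ne_zero.2 hu)⟩
  refine eq_zero_of_smul_eq ht ?_
  conv_lhs => rw [z]
  rw [z, Finset.smul_sum]
  refine Finset.sum_equiv (Equiv.subRight (s • φ)) (fun η => ?_) fun η _ => ?_
  · simp [he]
  · have := H.shift φ (η - s • φ) s
    rw [sub_add_cancel] at this
    rw [this, smul_smul, smul_smul, ← AddChar.map_add_eq_mul, ← AddChar.map_add_eq_mul,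
      Equiv.subRight_apply, sub_dotProduct, smul_dotProduct, smul_eq_mul, ← hst]
    congr 2
    ring

theorem P_w (H : WSys ρ ψ α w) (hψ : ψ ≠ 1) {e0 u0 φ : Fin d → F} (h0 : Ind e0 u0)
    (hφ : φ ⬝ᵥ e0 = 0) (η : Fin d → F) :
    P ρ ψ e0 u0 (w φ η) = 0 ∨ ∃ (c : k) (a : Fˣ),
      P ρ ψ e0 u0 (w φ η) = c • z ψ w φ ((a : F) • e0) ((a : F) • u0) := by
  have h : ∀ χ : perp e0, ρ (T e0 χ.1) (w φ η) = w φ (η - (η ⬝ᵥ e0) • χ.1) := fun χ => by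
    rw [H.equiv, ct_T_smul χ.2, ct_T_smul χ.2, hφ, zero_smul, sub_zero]
  rw [P_apply]
  simp only [h]
  rcases eq_or_ne (η ⬝ᵥ e0) 0 with hη | hη
  · left
    simp only [hη, zero_smul, sub_zero]
    rw [← Finset.sum_smul]
    obtain ⟨χ, h1, h2⟩ := h0.exists_sep
    have := sum_perp hψ (e := e0) (u := -u0) ⟨χ, h1, by simp [h2]⟩
    simp only [dotProduct_neg] at this
    rw [this, zero_smul]
  · right
    have hc : -(η ⬝ᵥ e0)⁻¹ ≠ 0 := by simpa using hη
    refine ⟨ψ (-(η ⬝ᵥ u0) * (η ⬝ᵥ e0)⁻¹), Units.mk0 _ hc, ?_⟩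
    rw [z, Finset.smul_sum, Units.val_mk0]
    refine Finset.sum_bij (fun χ _ => η - (η ⬝ᵥ e0) • χ.1) ?_ ?_ ?_ ?_
    · intro χ _
      have h1 : χ.1 ⬝ᵥ e0 = 0 := χ.2
      simp [h1, hη]
    · intro χ _ χ' _ hχ
      rw [sub_right_inj] at hχ
      exact Subtype.ext (smul_right_injective _ hη hχ)
    · intro ζ hζ
      replace hζ : ζ ⬝ᵥ e0 = η ⬝ᵥ e0 := by
        have : ζ ⬝ᵥ (-(η ⬝ᵥ e0)⁻¹ • e0) = -1 := by simpa using hζ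
        rw [dotProduct_smul, smul_eq_mul, neg_mul, neg_inj, inv_mul_eq_one₀ hη] at this
        exact this.symm
      refine ⟨⟨(η ⬝ᵥ e0)⁻¹ • (η - ζ), by simp [hζ]⟩, Finset.mem_univ _, ?_⟩
      simp [smul_smul, hη]
    · intro χ _
      rw [smul_smul, ← AddChar.map_add_eq_mul]
      congr 2
      rw [dotProduct_smul, sub_dotProduct, smul_dotProduct]
      simp only [smul_eq_mul]
      linear_combination (χ.1 ⬝ᵥ u0) * mul_inv_cancel₀ hη

theorem P_z_of_dot (H : WSys ρ ψ α w) (hψ : ψ ≠ 1) {e0 u0 φ0 φ e y : Fin d → F} (h0 : Ind e0 u0)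
    (h1 : φ0 ⬝ᵥ e0 = 0) (h2 : φ0 ⬝ᵥ u0 = 1) (hφ : φ ⬝ᵥ e0 = 0) :
    P ρ ψ e0 u0 (z ψ w φ e y) ∈ k ∙ z ψ w φ0 e0 u0 := by
  generalize hZ : k ∙ z ψ w φ0 e0 u0 = Z
  rw [z, map_sum]
  refine Submodule.sum_mem _ fun η _ => ?_
  rw [map_smul]
  refine Submodule.smul_mem _ _ ?_
  subst hZ
  rcases H.P_w hψ h0 hφ η with h | ⟨c, a, h⟩
  · rw [h]; exact zero_mem _
  · rw [h, z_smul H]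
    refine Submodule.smul_mem _ _ (Submodule.smul_mem _ _ ?_)
    have h3 : ((a : F) • φ) ⬝ᵥ e0 = 0 := by simp [hφ]
    by_cases h4 : ((a : F) • φ) ⬝ᵥ u0 = 1
    · rw [H.indep _ _ _ _ h3 h4 h1 h2]
      exact Submodule.mem_span_singleton_self _
    · rw [H.z_eq_zero hψ h3 h4]
      exact zero_mem _

theorem P_z_of_notMem (H : WSys ρ ψ α w) (hψ : ψ ≠ 1) {e0 u0 φ0 φ e y : Fin d → F}
    (h0 : Ind e0 u0) (h1 : φ0 ⬝ᵥ e0 = 0) (h2 : φ0 ⬝ᵥ u0 = 1) (he : φ ⬝ᵥ e = 0) (hy : φ ⬝ᵥ y = 1)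
    (hn : y ∉ Submodule.span F {e, e0}) : P ρ ψ e0 u0 (z ψ w φ e y) ∈ k ∙ z ψ w φ0 e0 u0 := by
  obtain ⟨φ', h3, h4⟩ := exists_sep _ hn
  rw [H.indep e y φ φ' he hy (h3 _ (Submodule.subset_span (by simp))) h4]
  exact H.P_z_of_dot hψ h0 h1 h2 (h3 _ (Submodule.subset_span (by simp)))

theorem P_z_of_notMem' (H : WSys ρ ψ α w) (hψ : ψ ≠ 1) {e0 u0 φ e y : Fin d → F}
    (he : φ ⬝ᵥ e = 0) (hy : φ ⬝ᵥ y = 1)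
    (hm : y ∈ Submodule.span F {e, e0}) (hn : u0 ∉ Submodule.span F {e, y}) :
    P ρ ψ e0 u0 (z ψ w φ e y) = 0 := by
  obtain ⟨χ, h1, h2⟩ := exists_sep _ hn
  obtain ⟨t, ht⟩ := AddChar.ne_one_iff.1 hψ
  have hχe : χ ⬝ᵥ e = 0 := h1 _ (Submodule.subset_span (by simp))
  have hχy : χ ⬝ᵥ y = 0 := h1 _ (Submodule.subset_span (by simp))
  have hχ0 : χ ⬝ᵥ e0 = 0 := h1 _ (mem_span_of_mem he hy hm)
  have h0 : (t • χ) ⬝ᵥ e0 = 0 := by simp [hχ0]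
  have h3 := P_T (ρ := ρ) (ψ := ψ) (u := u0) h0 (z ψ w φ e y)
  rw [z_equiv H.equiv, ct_T_smul h0, T_fix h0 (by simp [hχe]), T_fix h0 (by simp [hχy]),
    H.indep e y _ φ (by simp [hχe, he]) (by simp [hχy, hy]) he hy] at h3
  exact eq_zero_of_smul_eq (by simpa [h2] using ht) h3.symm

open Classical in
theorem card_smul_z (hψ : ψ ≠ 1) (φ e y x : Fin d → F) :
    (Fintype.card F : k) • z ψ w φ e y = ∑ t : F, ψ (-t) • ∑ c : Fˣ, (1 - ψ (c : F)) •
      z ψ w φ ((c : F)⁻¹ • (x - y - t • e)) (y + t • e) := by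
  have h1 : ∀ t : F, ∑ c : Fˣ, (1 - ψ (c : F)) •
      z ψ w φ ((c : F)⁻¹ • (x - y - t • e)) (y + t • e) =
      ∑ η : Fin d → F, (ψ (-(η ⬝ᵥ y) - t * η ⬝ᵥ e) - ψ (-(η ⬝ᵥ x))) • w φ η := by
    intro t
    have h2 : ∀ η : Fin d → F, (ψ (-(η ⬝ᵥ y) - t * η ⬝ᵥ e) - ψ (-(η ⬝ᵥ x))) • w φ η =
        ∑ c : Fˣ, if η ⬝ᵥ (x - y - t • e) = -c then
          (1 - ψ (c : F)) • ψ (-(η ⬝ᵥ (y + t • e))) • w φ η else 0 := by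
      intro η
      have h3 : ∀ s : F, η ⬝ᵥ (x - y - t • e) = -s →
          (ψ (-(η ⬝ᵥ y) - t * η ⬝ᵥ e) - ψ (-(η ⬝ᵥ x))) • w φ η =
          (1 - ψ s) • ψ (-(η ⬝ᵥ (y + t • e))) • w φ η := by
        intro s hs
        rw [smul_smul, sub_mul, one_mul, ← AddChar.map_add_eq_mul, ← neg_eq_iff_eq_neg.2 hs]
        simp only [dotProduct_add, dotProduct_sub, dotProduct_smul, smul_eq_mul]
        congr 3 <;> ring
      rcases eq_or_ne (η ⬝ᵥ (x - y - t • e)) 0 with hη | hη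
      · rw [h3 0 (by simp [hη]), Finset.sum_eq_zero]
        · simp
        · intro c _
          rw [if_neg]
          simp [hη]
      · have hη' : -(η ⬝ᵥ (x - y - t • e)) ≠ 0 := neg_ne_zero.2 hη
        rw [Finset.sum_eq_single (Units.mk0 _ hη'), if_pos (by simp)]
        · exact h3 _ (by simp)
        · intro c _ hc
          rw [if_neg]
          rintro h
          apply hc
          ext
          simp [h]
        · simp
    simp only [h2]
    rw [Finset.sum_comm]
    refine Finset.sum_congr rfl fun c _ => ?_
    rw [z, Finset.smul_sum, Finset.sum_filter]
    refine Finset.sum_congr rfl fun η _ => ?_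
    have : η ⬝ᵥ ((c : F)⁻¹ • (x - y - t • e)) = -1 ↔ η ⬝ᵥ (x - y - t • e) = -c := by
      rw [dotProduct_smul, smul_eq_mul, inv_mul_eq_iff_eq_mul₀ c.ne_zero, mul_neg_one]
    simp only [this]
  simp only [h1, Finset.smul_sum]
  rw [Finset.sum_comm, z, Finset.smul_sum, Finset.sum_filter]
  refine Finset.sum_congr rfl fun η _ => ?_
  have h4 : ∀ t : F, ψ (-t) • (ψ (-(η ⬝ᵥ y) - t * η ⬝ᵥ e) - ψ (-(η ⬝ᵥ x))) • w φ η =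
      (ψ (t * (-(1 + η ⬝ᵥ e))) * ψ (-(η ⬝ᵥ y)) - ψ (t * (-1)) * ψ (-(η ⬝ᵥ x))) • w φ η := by
    intro t
    rw [smul_smul, mul_sub]
    simp only [← AddChar.map_add_eq_mul]
    congr 3 <;> ring_nf
  have h5 : ∀ s : F, s ≠ 0 → ∑ t : F, ψ (t * s) = 0 := fun s hs =>
    sum_char_eq_zero hψ (LinearMap.mulRight F s) fun h =>
      hs (by simpa using LinearMap.congr_fun h 1)
  simp only [h4]
  rw [← Finset.sum_smul, Finset.sum_sub_distrib, ← Finset.sum_mul, ← Finset.sum_mul,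
    h5 (-1) (by simp), zero_mul, sub_zero]
  split_ifs with h
  · simp [h, smul_smul]
  · rw [h5, zero_mul, zero_smul]
    rw [neg_ne_zero, add_comm]
    exact fun h' => h (eq_neg_of_add_eq_zero_left h')

theorem P_z_mem (H : WSys ρ ψ α w) (hd : 3 ≤ d) (hq : (Fintype.card F : k) ≠ 0) (hψ : ψ ≠ 1)
    {e0 u0 φ0 φ e y : Fin d → F} (h0 : Ind e0 u0) (h1 : φ0 ⬝ᵥ e0 = 0) (h2 : φ0 ⬝ᵥ u0 = 1)
    (he : φ ⬝ᵥ e = 0) (hy : φ ⬝ᵥ y = 1) :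
    P ρ ψ e0 u0 (z ψ w φ e y) ∈ k ∙ z ψ w φ0 e0 u0 := by
  by_cases hm : y ∈ Submodule.span F {e, e0}
  swap
  · exact H.P_z_of_notMem hψ h0 h1 h2 he hy hm
  by_cases hu : u0 ∈ Submodule.span F {e, y}
  swap
  · rw [H.P_z_of_notMem' hψ he hy hm hu]
    exact zero_mem _
  obtain ⟨x, hx⟩ := exists_notMem (p := Submodule.span F {e, y})
    (by have := finrank_span_pair_le e y; omega)
  have hy' : y ∉ Submodule.span F {e, x - y} := by
    intro h
    obtain ⟨a, b, hab⟩ := Submodule.mem_span_pair.1 h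
    rcases eq_or_ne b 0 with rfl | hb
    · rw [← hab] at hy
      simp [he] at hy
    · apply hx
      refine Submodule.mem_span_pair.2 ⟨-b⁻¹ * a, b⁻¹ + 1, ?_⟩
      have : x - y = b⁻¹ • (y - a • e) := by
        rw [show y - a • e = b • (x - y) from sub_eq_iff_eq_add'.2 hab.symm, smul_smul,
          inv_mul_cancel₀ hb, one_smul]
      rw [← sub_add_cancel x y, this]
      module
  obtain ⟨ξ, h3, h4⟩ := exists_sep _ hy'
  have hξe : ξ ⬝ᵥ e = 0 := h3 _ (Submodule.subset_span (by simp))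
  have hξx : ξ ⬝ᵥ (x - y) = 0 := h3 _ (Submodule.subset_span (by simp))
  rw [H.indep e y φ ξ he hy hξe h4, ← Submodule.smul_mem_iff _ hq, ← map_smul,
    card_smul_z hψ ξ e y x, map_sum]
  refine Submodule.sum_mem _ fun t _ => ?_
  rw [map_smul, map_sum]
  refine Submodule.smul_mem _ _ (Submodule.sum_mem _ fun c _ => ?_)
  rw [map_smul]
  refine Submodule.smul_mem _ _ ?_
  have he2 : ξ ⬝ᵥ ((c : F)⁻¹ • (x - y - t • e)) = 0 := by
    rw [dotProduct_smul, dotProduct_sub, hξx, dotProduct_smul, hξe]; simp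
  have hy2 : ξ ⬝ᵥ (y + t • e) = 1 := by simp [h4, hξe]
  by_cases hm2 : y + t • e ∈ Submodule.span F {(c : F)⁻¹ • (x - y - t • e), e0}
  swap
  · exact H.P_z_of_notMem hψ h0 h1 h2 he2 hy2 hm2
  by_cases hu2 : u0 ∈ Submodule.span F {(c : F)⁻¹ • (x - y - t • e), y + t • e}
  swap
  · rw [H.P_z_of_notMem' hψ he2 hy2 hm2 hu2]
    exact zero_mem _
  have key : ∀ v ∈ Submodule.span F {e, y},
      v ∈ Submodule.span F {(c : F)⁻¹ • (x - y - t • e), y + t • e} →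
      ∃ b : F, b • (y + t • e) = v := by
    intro v hv hv2
    obtain ⟨a, b, hab⟩ := Submodule.mem_span_pair.1 hv2
    obtain ⟨a', b', hab'⟩ := Submodule.mem_span_pair.1 hv
    rcases eq_or_ne a 0 with rfl | ha
    · exact ⟨b, by rw [← hab, zero_smul, zero_add]⟩
    · exfalso
      apply hx
      have hac : a * (c : F)⁻¹ ≠ 0 := mul_ne_zero ha (inv_ne_zero c.ne_zero)
      rw [← Submodule.smul_mem_iff _ hac]
      have : (a * (c : F)⁻¹) • x = v - b • (y + t • e) + (a * (c : F)⁻¹) • (y + t • e) := by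
        rw [← hab]; module
      rw [this, ← hab']
      exact Submodule.mem_span_pair.2 ⟨a' - b * t + (a * (c : F)⁻¹) * t, b' - b + a * (c : F)⁻¹,
        by module⟩
  obtain ⟨a, ha⟩ := key e0 (mem_span_of_mem he hy hm) (mem_span_of_mem he2 hy2 hm2)
  obtain ⟨b, hb⟩ := key u0 hu hu2
  exfalso
  have ha0 : a ≠ 0 := by
    rintro rfl
    exact h0.1 (by rw [← ha, zero_smul])
  apply h0.2
  rw [← ha, ← hb]
  exact Submodule.mem_span_singleton.2 ⟨b * a⁻¹, by
    rw [smul_smul, mul_assoc, inv_mul_cancel₀ ha0, mul_one]⟩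

/-- If one of the vectors `z` vanishes, so does some `w` at an independent pair. -/
theorem z_ne_zero (H : WSys ρ ψ α w) (hd : 3 ≤ d) (hq : (Fintype.card F : k) ≠ 0) (hψ : ψ ≠ 1)
    (hw : ∀ φ η, Ind φ η → w φ η ≠ 0) {φ e u : Fin d → F} (he0 : e ≠ 0) (he : φ ⬝ᵥ e = 0)
    (hu : φ ⬝ᵥ u = 1) : z ψ w φ e u ≠ 0 := by
  intro h
  have hz : ∀ x, z ψ w φ e x = 0 := by
    intro x
    by_cases hx : φ ⬝ᵥ x = 1
    · obtain ⟨g, h1, h2⟩ := trans_ind hd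
        (ind_of_dot he0 he (hu.trans_ne one_ne_zero)) (ind_of_dot he0 he (hx.trans_ne one_ne_zero))
      have h3 := congrArg (ρ g) h
      rw [z_equiv H.equiv, map_zero] at h3
      rw [← h3, h1, h2]
      refine H.indep e x _ _ he hx ?_ ?_
      · rw [← h1, ct_dot_smul, he]
      · rw [← h2, ct_dot_smul, hu]
    · exact H.z_eq_zero hψ he hx
  obtain ⟨ζ, -, hζ⟩ := exists_sep ⊥ (y := e) (by simpa using he0)
  have hφ : φ ≠ 0 := by rintro rfl; simp at hu
  have hI : Ind φ (-ζ) := ind_of_dot (φ := e) hφ (by rwa [dotProduct_comm])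
    (by rw [dotProduct_neg, dotProduct_comm, hζ]; simp)
  apply hw φ (-ζ) hI
  have h5 : ∑ x, ψ ((-ζ) ⬝ᵥ x) • z ψ w φ e x = (Fintype.card F : k) ^ d • w φ (-ζ) := by
    simp only [z, Finset.smul_sum]
    rw [Finset.sum_comm, Finset.sum_eq_single (-ζ)]
    · simp [smul_smul, ← AddChar.map_add_eq_mul, ← Nat.cast_smul_eq_nsmul k]
    · intro η _ hη
      simp only [smul_smul, ← AddChar.map_add_eq_mul, ← sub_eq_add_neg, ← sub_dotProduct]
      rw [← Finset.sum_smul, sum_dot hψ (sub_ne_zero.2 hη.symm), zero_smul]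
    · simp [hζ]
  simp only [hz, smul_zero, Finset.sum_const_zero] at h5
  exact (smul_eq_zero.1 h5.symm).resolve_left (pow_ne_zero d hq)

end WSys

end

section

theorem _root_.Representation.IsIrred.exists_equiv_of_prod {k H V₁ V₂ : Type*} [Field k] [Group H]
    [AddCommGroup V₁] [Module k V₁] [AddCommGroup V₂] [Module k V₂]
    {ρ₁ : Representation k H V₁} {ρ₂ : Representation k H V₂} (h₁ : ρ₁.IsIrred) (h₂ : ρ₂.IsIrred)
    (D : Submodule k (V₁ × V₂)) (hD : ∀ g, ∀ v ∈ D, ρ₁.prod ρ₂ g v ∈ D) (htop : D ≠ ⊤)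
    {v : V₁ × V₂} (hv : v ∈ D) (hv₁ : v.1 ≠ 0) (hv₂ : v.2 ≠ 0) :
    ∃ e : V₁ ≃ₗ[k] V₂, ∀ g x, e (ρ₁ g x) = ρ₂ g (e x) := by
  have s₁ : ∀ a, ∃ b, (a, b) ∈ D := by
    have : D.map (LinearMap.fst k V₁ V₂) = ⊤ := by
      refine (h₁ _ ?_).resolve_left fun h => ?_
      · rintro g _ ⟨x, hx, rfl⟩
        exact ⟨_, hD g x hx, rfl⟩
      · exact hv₁ ((Submodule.mem_bot k).1 (h ▸ Submodule.mem_map_of_mem hv))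
    intro a
    obtain ⟨x, hx, rfl⟩ : a ∈ D.map (LinearMap.fst k V₁ V₂) := this ▸ Submodule.mem_top
    exact ⟨x.2, hx⟩
  have s₂ : ∀ b, ∃ a, (a, b) ∈ D := by
    have : D.map (LinearMap.snd k V₁ V₂) = ⊤ := by
      refine (h₂ _ ?_).resolve_left fun h => ?_
      · rintro g _ ⟨x, hx, rfl⟩
        exact ⟨_, hD g x hx, rfl⟩
      · exact hv₂ ((Submodule.mem_bot k).1 (h ▸ Submodule.mem_map_of_mem hv))
    intro b
    obtain ⟨x, hx, rfl⟩ : b ∈ D.map (LinearMap.snd k V₁ V₂) := this ▸ Submodule.mem_top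
    exact ⟨x.1, hx⟩
  have k₁ : D.comap (LinearMap.inl k V₁ V₂) = ⊥ := by
    refine (h₁ _ ?_).resolve_right fun h => htop ?_
    · intro g x hx
      simpa using hD g _ hx
    · refine (Submodule.eq_top_iff'.2 fun x => ?_)
      obtain ⟨a, ha⟩ := s₂ x.2
      have hx : (x.1 - a, (0 : V₂)) ∈ D :=
        (h ▸ Submodule.mem_top : x.1 - a ∈ D.comap (LinearMap.inl k V₁ V₂))
      simpa using add_mem hx ha
  have k₂ : D.comap (LinearMap.inr k V₁ V₂) = ⊥ := by
    refine (h₂ _ ?_).resolve_right fun h => htop ?_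
    · intro g x hx
      simpa using hD g _ hx
    · refine (Submodule.eq_top_iff'.2 fun x => ?_)
      obtain ⟨b, hb⟩ := s₁ x.1
      have hx : ((0 : V₁), x.2 - b) ∈ D :=
        (h ▸ Submodule.mem_top : x.2 - b ∈ D.comap (LinearMap.inr k V₁ V₂))
      simpa using add_mem hx hb
  have b₁ : Function.Bijective ((LinearMap.fst k V₁ V₂).domRestrict D) := by
    refine ⟨?_, fun a => ?_⟩
    · rw [← LinearMap.ker_eq_bot, LinearMap.ker_eq_bot']
      rintro ⟨⟨a, b⟩, hx⟩ h
      obtain rfl : a = 0 := h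
      have : b ∈ D.comap (LinearMap.inr k V₁ V₂) := hx
      rw [k₂, Submodule.mem_bot] at this
      simp [this]
    · obtain ⟨b, hb⟩ := s₁ a
      exact ⟨⟨_, hb⟩, rfl⟩
  have b₂ : Function.Bijective ((LinearMap.snd k V₁ V₂).domRestrict D) := by
    refine ⟨?_, fun b => ?_⟩
    · rw [← LinearMap.ker_eq_bot, LinearMap.ker_eq_bot']
      rintro ⟨⟨a, b⟩, hx⟩ h
      obtain rfl : b = 0 := h
      have : a ∈ D.comap (LinearMap.inl k V₁ V₂) := hx
      rw [k₁, Submodule.mem_bot] at this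
      simp [this]
    · obtain ⟨a, ha⟩ := s₂ b
      exact ⟨⟨_, ha⟩, rfl⟩
  refine ⟨(LinearEquiv.ofBijective _ b₁).symm.trans (LinearEquiv.ofBijective _ b₂), fun g x => ?_⟩
  obtain ⟨y, rfl⟩ := (LinearEquiv.ofBijective _ b₁).surjective x
  have : ρ₁ g (LinearEquiv.ofBijective _ b₁ y) =
      LinearEquiv.ofBijective _ b₁ ⟨_, hD g y.1 y.2⟩ := rfl
  rw [this]
  simp only [LinearEquiv.trans_apply, LinearEquiv.symm_apply_apply]
  rfl

variable {k : Type*} [Field k] {F : Type*} [Field F] [Fintype F] {d : ℕ}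
  {V₁ V₂ : Type*} [AddCommGroup V₁] [Module k V₁] [AddCommGroup V₂] [Module k V₂]
  {ρ₁ : Representation k (SL d F) V₁} {ρ₂ : Representation k (SL d F) V₂} {ψ : AddChar F k}
  {α : Fˣ →* k} {w₁ : (Fin d → F) → (Fin d → F) → V₁} {w₂ : (Fin d → F) → (Fin d → F) → V₂}

theorem z_prod (φ e u : Fin d → F) :
    z ψ (fun φ η => (w₁ φ η, w₂ φ η)) φ e u = (z ψ w₁ φ e u, z ψ w₂ φ e u) := by
  simp [z, Prod.ext_iff, Prod.fst_sum, Prod.snd_sum]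

theorem WSys.prod (H₁ : WSys ρ₁ ψ α w₁) (H₂ : WSys ρ₂ ψ α w₂) :
    WSys (ρ₁.prod ρ₂) ψ α fun φ η => (w₁ φ η, w₂ φ η) where
  equiv g φ η := Prod.ext (H₁.equiv g φ η) (H₂.equiv g φ η)
  shift φ η t := Prod.ext (H₁.shift φ η t) (H₂.shift φ η t)
  scale φ η c := Prod.ext (H₁.scale φ η c) (H₂.scale φ η c)
  indep e u φ φ' h1 h2 h3 h4 := by
    rw [z_prod, z_prod, H₁.indep e u φ φ' h1 h2 h3 h4, H₂.indep e u φ φ' h1 h2 h3 h4]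

theorem WSys.exists_equiv (H₁ : WSys ρ₁ ψ α w₁) (H₂ : WSys ρ₂ ψ α w₂) (hd : 3 ≤ d)
    (hq : (Fintype.card F : k) ≠ 0) (hψ : ψ ≠ 1) (hw₁ : ∀ φ η, Ind φ η → w₁ φ η ≠ 0)
    (hw₂ : ∀ φ η, Ind φ η → w₂ φ η ≠ 0) (h₁ : ρ₁.IsIrred) (h₂ : ρ₂.IsIrred) :
    ∃ e : V₁ ≃ₗ[k] V₂, ∀ g x, e (ρ₁ g x) = ρ₂ g (e x) := by
  have H := H₁.prod H₂
  set w : (Fin d → F) → (Fin d → F) → V₁ × V₂ := fun φ η => (w₁ φ η, w₂ φ η)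
  let D : Submodule k (V₁ × V₂) :=
    Submodule.span k {v | ∃ φ e y : Fin d → F, φ ⬝ᵥ e = 0 ∧ φ ⬝ᵥ y = 1 ∧ v = z ψ w φ e y}
  obtain ⟨e, u, heu⟩ := exists_ind (F := F) (d := d) (by omega)
  obtain ⟨φ, he, hu⟩ := heu.exists_sep
  have hz₁ := H₁.z_ne_zero hd hq hψ hw₁ heu.1 he hu
  have hz₂ := H₂.z_ne_zero hd hq hψ hw₂ heu.1 he hu
  have hz : z ψ w φ e u = (z ψ w₁ φ e u, z ψ w₂ φ e u) := z_prod φ e u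
  refine h₁.exists_equiv_of_prod h₂ D ?_ ?_ (v := z ψ w φ e u)
    (Submodule.subset_span ⟨φ, e, u, he, hu, rfl⟩) (by rw [hz]; exact hz₁) (by rw [hz]; exact hz₂)
  · intro g v hv
    induction hv using Submodule.span_induction with
    | mem v hv =>
      obtain ⟨φ', e', y', h3, h4, rfl⟩ := hv
      rw [z_equiv H.equiv]
      exact Submodule.subset_span ⟨_, _, _, by rw [ct_dot_smul, h3], by rw [ct_dot_smul, h4], rfl⟩
    | zero => rw [map_zero]; exact zero_mem _
    | add x y _ _ hx hy => rw [map_add]; exact add_mem hx hy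
    | smul c x _ hx => rw [map_smul]; exact Submodule.smul_mem _ _ hx
  · intro htop
    have hP : ∀ v ∈ D, P (ρ₁.prod ρ₂) ψ e u v ∈ k ∙ z ψ w φ e u := by
      intro v hv
      induction hv using Submodule.span_induction with
      | mem v hv =>
        obtain ⟨φ', e', y', h3, h4, rfl⟩ := hv
        exact H.P_z_mem hd hq hψ heu he hu h3 h4
      | zero => rw [map_zero]; exact zero_mem _
      | add x y _ _ hx hy => rw [map_add]; exact add_mem hx hy
      | smul c x _ hx => rw [map_smul]; exact Submodule.smul_mem _ _ hx
    have hE : (z ψ w₁ φ e u, (0 : V₂)) ∈ E (ρ₁.prod ρ₂) ψ e u := fun χ hχ =>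
      Prod.ext (z_mem H₁.equiv u he χ hχ) (by simp)
    have h3 := hP _ (htop ▸ Submodule.mem_top : (z ψ w₁ φ e u, (0 : V₂)) ∈ D)
    rw [P_of_mem hE, hz] at h3
    obtain ⟨c, hc⟩ := Submodule.mem_span_singleton.1 h3
    have hc2 : c • z ψ w₂ φ e u = 0 := by simpa using congrArg Prod.snd hc
    have hc0 : c = 0 := (smul_eq_zero.1 hc2).resolve_right hz₂
    have hc1 := congrArg Prod.fst hc
    rw [hc0, zero_smul, card_perp, Nat.cast_pow] at hc1
    exact (smul_ne_zero (pow_ne_zero _ hq) hz₁) hc1.symm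

end

section

theorem card_monoidHom_le (F k : Type*) [Field F] [Fintype F] [Field k] :
    Finite (Fˣ →* k) ∧ Nat.card (Fˣ →* k) ≤ Fintype.card F - 1 := by
  classical
  have h := linearIndependent_monoidHom Fˣ k
  have : Finite (Fˣ →* k) := h.finite
  have := Fintype.ofFinite (Fˣ →* k)
  refine ⟨inferInstance, ?_⟩
  have h1 := h.fintype_card_le_finrank
  rwa [Module.finrank_fintype_fun_eq_card, Fintype.card_units, ← Nat.card_eq_fintype_card] at h1

section

variable {k : Type*} [Field k] [IsAlgClosed k] {F : Type*} [Field F] [Fintype F] {d n : ℕ}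

/-- The isomorphism classes of `n`-dimensional nontrivial irreducible representations. -/
abbrev IrrClass (k : Type*) [Field k] (F : Type*) [Field F] (d n : ℕ) :=
  Quotient (repIsoSetoid k (SL d F) n fun ρ => ρ ≠ 1 ∧ ρ.IsIrred)

theorem card_irrClass_le (hq : (Fintype.card F : k) ≠ 0) (hg : Good d (Fintype.card F) n) :
    Finite (IrrClass k F d n) ∧ Nat.card (IrrClass k F d n) ≤ Fintype.card F - 1 := by
  obtain ⟨ψ, hψ⟩ := exists_addChar (F := F) (k := k) hq
  have hn : Module.finrank k (Fin n → k) = n := by simp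
  have H : ∀ ρ : {ρ : Representation k (SL d F) (Fin n → k) // ρ ≠ 1 ∧ ρ.IsIrred},
      ∃ (α : Fˣ →* k) (w : (Fin d → F) → (Fin d → F) → Fin n → k),
        (∀ φ η, Ind φ η → w φ η ≠ 0) ∧ WSys ρ.1 ψ α w := fun ρ =>
    exists_wsys hq hψ ρ.2.1 (hn.symm ▸ hg)
  choose α w hw hW using H
  obtain ⟨hfin, hcard⟩ := card_monoidHom_le F k
  have hinj : Function.Injective fun c : IrrClass k F d n => α c.out := by
    intro a b hab
    rw [← a.out_eq, ← b.out_eq]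
    exact Quotient.sound ((hW a.out).exists_equiv ((show α a.out = α b.out from hab) ▸ hW b.out)
      hg.three_le hq hψ (hw _) (hw _) a.out.2.2 b.out.2.2)
  exact ⟨Finite.of_injective _ hinj, (Nat.card_le_card_of_injective _ hinj).trans hcard⟩

theorem le_of_irrClass (hq : (Fintype.card F : k) ≠ 0) (hg : Good d (Fintype.card F) n)
    (c : IrrClass k F d n) : Fintype.card F ^ (d - 1) ≤ n + 1 := by
  obtain ⟨ψ, hψ⟩ := exists_addChar (F := F) (k := k) hq
  have hn : Module.finrank k (Fin n → k) = n := by simp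
  obtain ⟨e, u, heu⟩ := exists_ind (F := F) (d := d) (by have := hg.three_le; omega)
  have h1 := finrank_E_eq_one hq hψ c.out.2.1 (hn.symm ▸ hg) heu
  have h2 := finrank_bound (ρ := c.out.1) hg.three_le hq hψ heu
  rw [h1, hn] at h2
  omega

end

theorem add_one_pow_ge (a s : ℕ) : a ^ (s + 2) + 2 * a ^ (s + 1) + 1 ≤ (a + 1) ^ (s + 2) := by
  induction s with
  | zero => apply le_of_eq; ring
  | succ s ih =>
    calc a ^ (s + 1 + 2) + 2 * a ^ (s + 1 + 1) + 1
        ≤ (a ^ (s + 2) + 2 * a ^ (s + 1) + 1) * (a + 1) := by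
          rw [show (a ^ (s + 2) + 2 * a ^ (s + 1) + 1) * (a + 1) =
            a ^ (s + 1 + 2) + 2 * a ^ (s + 1 + 1) + 1 + (a ^ (s + 2) + 2 * a ^ (s + 1) + a) by ring]
          omega
      _ ≤ (a + 1) ^ (s + 2) * (a + 1) := Nat.mul_le_mul_right _ ih
      _ = _ := by ring

theorem card_lt_of_forall {ι : Type*} {b : ℝ} (hb : 0 < b) (h : ι → (Nat.card ι : ℝ) < b) :
    (Nat.card ι : ℝ) < b := by
  cases isEmpty_or_nonempty ι with
  | inl _ => rwa [Nat.card_of_isEmpty, Nat.cast_zero]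
  | inr hN => exact h hN.some

/-- The dimension intervals attached to different prime powers are disjoint. -/
theorem eq_of_bounds {r n q q' : ℕ} (hr : 2 ≤ r) (hq : 2 ≤ q)
    (h1 : n * (q - 1) ≤ q ^ (r + 1) - 1) (h2 : q' ^ r ≤ n + 1) : q' ≤ q := by
  by_contra! hlt
  obtain ⟨s, rfl⟩ := Nat.exists_eq_add_of_le' hr
  have h3 := (add_one_pow_ge q s).trans ((Nat.pow_le_pow_left hlt _).trans h2)
  obtain ⟨a, rfl⟩ := Nat.exists_eq_add_of_le' hq
  have h4 : ((a + 2) ^ (s + 2) + 2 * (a + 2) ^ (s + 1)) * (a + 1) ≤ (a + 2) ^ (s + 3) - 1 :=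
    (Nat.mul_le_mul_right _ (by omega)).trans h1
  have h5 : ((a + 2) ^ (s + 2) + 2 * (a + 2) ^ (s + 1)) * (a + 1) =
      (a + 2) ^ (s + 3) + a * (a + 2) ^ (s + 1) := by ring
  have h6 : 0 < (a + 2) ^ (s + 3) := by positivity
  rw [h5] at h4
  omega

theorem sub_one_lt_rpow {r n q : ℕ} (hr : 2 ≤ r) (hq : 2 ≤ q) (h : q ^ r ≤ n + 1) :
    ((q - 1 : ℕ) : ℝ) < (n : ℝ) ^ ((1 : ℝ) / r) := by
  obtain ⟨s, rfl⟩ := Nat.exists_eq_add_of_le' hr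
  obtain ⟨a, rfl⟩ := Nat.exists_eq_add_of_le' hq
  have h1 := (add_one_pow_ge (a + 1) s).trans h
  have h2 : 0 < (a + 1) ^ (s + 1) := by positivity
  have h3 : (a + 1) ^ (s + 2) < n := by omega
  have h4 : ((a + 1 : ℕ) : ℝ) ^ (s + 2) < n := by exact_mod_cast h3
  have h5 := Real.rpow_lt_rpow (by positivity) h4 (z := 1 / ((s + 2 : ℕ) : ℝ)) (by positivity)
  rwa [one_div, Real.pow_rpow_inv_natCast (by positivity) (by omega), ← one_div] at h5

theorem Good.of_bounds {ℓ r n q : ℕ} (hr : 2 ≤ r) (hq : IsPrimePow q ∧ ¬ ℓ ∣ q ∧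
    ¬ (r = 2 ∧ q ∈ ({2, 3, 4, 5} : Set ℕ)) ∧ ¬ (r = 3 ∧ q ∈ ({2, 3} : Set ℕ)) ∧
    ¬ (r = 5 ∧ q ∈ ({2, 3} : Set ℕ)) ∧ (n : ℚ) ≤ ((q : ℚ) ^ (r + 1) - 1) / ((q : ℚ) - 1)) :
    Good (r + 1) q n := by
  obtain ⟨hpp, -, h2, h3, -, hb⟩ := hq
  have hq2 : 2 ≤ q := hpp.two_le
  simp only [Set.mem_insert_iff, Set.mem_singleton_iff] at h2 h3
  refine ⟨by omega, hq2, by omega, by omega, ?_⟩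
  have hq2' : (2 : ℚ) ≤ q := by exact_mod_cast hq2
  rw [le_div_iff₀ (by linarith)] at hb
  have h1 : 1 ≤ q ^ (r + 1) := Nat.one_le_pow _ _ (by omega)
  have : ((n * (q - 1) : ℕ) : ℚ) ≤ ((q ^ (r + 1) - 1 : ℕ) : ℚ) := by
    push_cast [Nat.cast_sub h1, Nat.cast_sub (show 1 ≤ q by omega)]
    exact hb
  exact_mod_cast this

end

end SLRep

theorem count_below_gap_SL (ℓ : ℕ) (hℓ : ℓ.Prime)
    (k : Type*) [Field k] [IsAlgClosed k] [CharP k ℓ]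
    (r n : ℕ) (hr : 2 ≤ r) (hn : 1 < n)
    (F : ℕ → Type*) [∀ q, Field (F q)] [∀ q, Fintype (F q)]
    (hF : ∀ q, IsPrimePow q → Fintype.card (F q) = q) :
    (Nat.card ((q : {q : ℕ // IsPrimePow q ∧ ¬ ℓ ∣ q ∧
        ¬ (r = 2 ∧ q ∈ ({2, 3, 4, 5} : Set ℕ)) ∧
        ¬ (r = 3 ∧ q ∈ ({2, 3} : Set ℕ)) ∧
        ¬ (r = 5 ∧ q ∈ ({2, 3} : Set ℕ)) ∧
        (n : ℚ) ≤ ((q : ℚ) ^ (r + 1) - 1) / ((q : ℚ) - 1)}) ×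
      Quotient (repIsoSetoid k (Matrix.SpecialLinearGroup (Fin (r + 1)) (F q)) n
        (fun ρ => ρ ≠ 1 ∧ ρ.IsIrred))) : ℝ) < (n : ℝ) ^ ((1 : ℝ) / r) := by
  have hcard : ∀ q : ℕ, IsPrimePow q → ¬ ℓ ∣ q → (Fintype.card (F q) : k) ≠ 0 := by
    intro q hq hl h
    rw [hF q hq] at h
    exact hl ((CharP.cast_eq_zero_iff k ℓ q).1 h)
  have hgood : ∀ q : ℕ, IsPrimePow q → SLRep.Good (r + 1) q n →
      SLRep.Good (r + 1) (Fintype.card (F q)) n := fun q hq h => (hF q hq).symm ▸ h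
  have hle : ∀ q : ℕ, IsPrimePow q → ¬ ℓ ∣ q → SLRep.Good (r + 1) q n →
      SLRep.IrrClass k (F q) (r + 1) n → q ^ r ≤ n + 1 := fun q hq hl hg c => by
    simpa [hF q hq] using SLRep.le_of_irrClass (hcard q hq hl) (hgood q hq hg) c
  have hn0 : 0 < (n : ℝ) := by exact_mod_cast (by omega : 0 < n)
  refine SLRep.card_lt_of_forall (Real.rpow_pos_of_pos hn0 _) ?_
  rintro ⟨⟨q, hq⟩, c⟩
  have hg := SLRep.Good.of_bounds hr hq
  have hc := hle q hq.1 hq.2.1 hg c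
  obtain ⟨hfin, hcq⟩ := SLRep.card_irrClass_le (hcard q hq.1 hq.2.1) (hgood q hq.1 hg)
  rw [hF q hq.1] at hcq
  refine lt_of_le_of_lt ?_ (SLRep.sub_one_lt_rpow hr hg.two_le hc)
  rw [Nat.cast_le]
  refine le_trans ?_ hcq
  refine Nat.card_le_card_of_surjective
    (fun x : SLRep.IrrClass k (F q) (r + 1) n => ⟨⟨q, hq⟩, x⟩) ?_
  rintro ⟨⟨q', hq'⟩, c'⟩
  have hg' := SLRep.Good.of_bounds hr hq'
  have hc' := hle q' hq'.1 hq'.2.1 hg' c'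
  obtain rfl : q' = q := le_antisymm
    (SLRep.eq_of_bounds hr hg.two_le hg.bound hc') (SLRep.eq_of_bounds hr hg'.two_le hg'.bound hc)
  exact ⟨c', rfl⟩
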